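/- arXiv:2504.19743 — 8 statements merged into one kernel-verified Lean document; each statement's English description precedes it below -/
import Mathlib

section
/- Let 1 < p < ∞ and let q satisfy 1/p + 1/q = 1. For every sequence a = {a_m}_{m=0}^∞ of complex numbers with ∑_{m=0}^∞ |a_m|^p < ∞, one has ∑_{n=0}^∞ |∑_{m=0}^∞ a_m/(m+n+1)|^p ≤ (π·csc(π/p))^p · ∑_{m=0}^∞ |a_m|^p. -/
namespace HilbertIneq
open Real MeasureTheory Set

lemma beta_ii (n : ℕ) (s : ℝ) (hs : 0 < s) :
    IntervalIntegrable (fun x : ℝ => x ^ n * (1 - x) ^ (s - 1)) volume 0 1 := by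
  have h1 : IntervalIntegrable (fun x : ℝ => x ^ (s - 1)) volume 0 1 :=
    intervalIntegral.intervalIntegrable_rpow' (by linarith)
  have h2 := (h1.comp_sub_left 1).symm
  simp only [sub_self, sub_zero] at h2
  exact h2.continuousOn_mul (by fun_prop)

lemma beta_val (n : ℕ) (s : ℝ) (hs : 0 < s) :
    ∫ x in (0:ℝ)..1, x ^ n * (1 - x) ^ (s - 1) = n.factorial * Gamma s / Gamma (n + 1 + s) := by
  have h := Complex.betaIntegral_eq_Gamma_mul_div ((n:ℂ) + 1) (s : ℂ)
    (by simp; positivity) (by simpa using hs)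
  rw [Complex.Gamma_nat_eq_factorial, Complex.Gamma_ofReal,
    show ((n:ℂ) + 1 + s) = ((n + 1 + s : ℝ) : ℂ) by push_cast; ring, Complex.Gamma_ofReal,
    Complex.betaIntegral] at h
  apply Complex.ofReal_injective
  push_cast
  rw [← h, ← intervalIntegral.integral_ofReal]
  apply intervalIntegral.integral_congr
  intro x hx
  rw [uIcc_of_le zero_le_one] at hx
  have h1 : 0 ≤ 1 - x := by linarith [hx.2]
  simp only [add_sub_cancel_right, Complex.cpow_natCast]
  rw [Complex.ofReal_mul, Complex.ofReal_cpow h1]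
  push_cast
  rfl

/-- Partial sums of the binomial series. -/
lemma binom_le (M : ℕ) (s x : ℝ) (hs1 : s < 1) (hx0 : 0 ≤ x) (hx1 : x < 1) :
    ∑ m ∈ Finset.range M, Gamma (m + 1 - s) / m.factorial * x ^ m
      ≤ Gamma (1 - s) * (1 - x) ^ (s - 1) := by
  have hI : ∀ m : ℕ, IntegrableOn (fun t : ℝ => x ^ m / m.factorial *
      (exp (-t) * t ^ (((m:ℝ) + 1 - s) - 1))) (Ioi 0) := fun m =>
    (GammaIntegral_convergent (by have : (0:ℝ) ≤ m := by positivity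
                                  linarith)).const_mul _
  have hlhs : ∑ m ∈ Finset.range M, Gamma (m + 1 - s) / m.factorial * x ^ m
      = ∫ t in Ioi (0:ℝ), ∑ m ∈ Finset.range M, x ^ m / m.factorial *
      (exp (-t) * t ^ (((m:ℝ) + 1 - s) - 1)) := by
    rw [integral_finsetSum _ (fun m _ => hI m)]
    refine Finset.sum_congr rfl fun m _ => ?_
    rw [integral_const_mul, ← Gamma_eq_integral (by have : (0:ℝ) ≤ m := by positivity
                                                    linarith)]
    ring
  have hrhs := integral_rpow_mul_exp_neg_mul_Ioi (a := 1 - s) (r := 1 - x) (by linarith) (by linarith)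
  have hR : Gamma (1 - s) * (1 - x) ^ (s - 1)
      = ∫ t in Ioi (0:ℝ), t ^ ((1 - s) - 1) * exp (-((1 - x) * t)) := by
    rw [hrhs, one_div, inv_rpow (by linarith), ← rpow_neg (by linarith), mul_comm]
    ring_nf
  rw [hlhs, hR]
  refine setIntegral_mono_on (integrable_finsetSum _ fun m _ => hI m) ?_ measurableSet_Ioi ?_
  · have := integrableOn_rpow_mul_exp_neg_mul_rpow (p := 1) (s := 1 - s - 1) (b := 1 - x)
      (by linarith) one_pos (by linarith)
    simp only [rpow_one, neg_mul] at this
    exact this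
  · intro t ht
    have ht : 0 < t := ht
    have h := sum_le_exp_of_nonneg (x := x * t) (by positivity) M
    calc _ = t ^ (1 - s - 1) * exp (-t) * ∑ m ∈ Finset.range M, (x * t) ^ m / m.factorial := by
          rw [Finset.mul_sum]
          refine Finset.sum_congr rfl fun m _ => ?_
          rw [show ((m:ℝ) + 1 - s) - 1 = (1 - s - 1) + m by ring, rpow_add ht, rpow_natCast, mul_pow]
          ring
      _ ≤ t ^ (1 - s - 1) * exp (-t) * exp (x * t) := by gcongr
      _ = _ := by
          rw [mul_assoc, ← exp_add]
          ring_nf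

lemma schur_sum (M n : ℕ) (s : ℝ) (hs0 : 0 < s) (hs1 : s < 1) :
    ∑ m ∈ Finset.range M, (1 / ((m:ℝ) + n + 1)) * (Gamma (m + 1 - s) / m.factorial)
      ≤ (π * (sin (π * s))⁻¹) * (n.factorial / Gamma (n + 1 + s)) := by
  have hG := Gamma_mul_Gamma_one_sub s
  calc _ = ∫ x in (0:ℝ)..1, ∑ m ∈ Finset.range M,
          Gamma (m + 1 - s) / m.factorial * x ^ (m + n) := by
        rw [intervalIntegral.integral_finsetSum
          (fun (m : ℕ) _ => (by fun_prop : Continuous fun x : ℝ =>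
            Gamma (m + 1 - s) / m.factorial * x ^ (m + n)).intervalIntegrable _ _)]
        refine Finset.sum_congr rfl fun m _ => ?_
        rw [intervalIntegral.integral_const_mul, integral_pow]
        simp
        ring
    _ ≤ ∫ x in (0:ℝ)..1, Gamma (1 - s) * (x ^ n * (1 - x) ^ (s - 1)) := by
        refine intervalIntegral.integral_mono_on_of_le_Ioo zero_le_one
          (Continuous.intervalIntegrable (by fun_prop) _ _) ((beta_ii n s hs0).const_mul _) ?_
        intro x hx
        have h := binom_le M s x hs1 hx.1.le hx.2
        have h2 := mul_le_mul_of_nonneg_left h (pow_nonneg hx.1.le n)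
        refine le_trans (le_of_eq ?_) (h2.trans (le_of_eq (by ring)))
        rw [Finset.mul_sum]
        refine Finset.sum_congr rfl fun m _ => ?_
        ring
    _ = _ := by
        rw [intervalIntegral.integral_const_mul, beta_val n s hs0, ← div_eq_mul_inv, ← hG]
        ring

lemma fact_le (n : ℕ) (t : ℝ) (h0 : 0 < t) (h1 : t < 1) :
    (n.factorial : ℝ) ≤ Gamma (n + t) ^ t * Gamma (n + 1 + t) ^ (1 - t) := by
  have hn : (0:ℝ) ≤ n := by positivity
  have := Gamma_mul_add_mul_le_rpow_Gamma_mul_rpow_Gamma (s := n + t) (t := n + 1 + t)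
    (a := t) (b := 1 - t) (by linarith) (by linarith) h0 (by linarith) (by ring)
  rw [← Gamma_nat_eq_factorial]
  convert this using 2
  ring

lemma wV (p : ℝ) (hp : 1 < p) (n : ℕ) :
    ((n.factorial : ℝ) / Gamma (n + 1 + 1 / p)) ^ (p - 1) ≤
      Gamma (n + 1 - (1 - 1 / p)) / n.factorial := by
  have hp0 : 0 < p := by linarith
  have h := fact_le n (1 / p) (by positivity) (by rw [div_lt_one hp0]; exact hp)
  have hf : (0:ℝ) < n.factorial := by positivity
  have hA : 0 < Gamma (n + 1 / p) := Gamma_pos_of_pos (by positivity)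
  have hB : 0 < Gamma (n + 1 + 1 / p) := Gamma_pos_of_pos (by positivity)
  rw [show (n:ℝ) + 1 - (1 - 1 / p) = n + 1 / p by ring, div_rpow hf.le hB.le,
    div_le_div_iff₀ (by positivity) hf]
  have h2 := rpow_le_rpow hf.le h hp0.le
  rw [mul_rpow (by positivity) (by positivity), ← rpow_mul hA.le, ← rpow_mul hB.le,
    show 1 / p * p = 1 by field_simp, show (1 - 1 / p) * p = p - 1 by field_simp, rpow_one] at h2
  rwa [rpow_sub_one hf.ne', div_mul_cancel₀ _ hf.ne']

lemma wW (p : ℝ) (hp : 1 < p) (n : ℕ) :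
    (n.factorial : ℝ) / Gamma (n + 1 + (1 - 1 / p)) ≤
      (Gamma (n + 1 - 1 / p) / n.factorial) ^ (p - 1) := by
  have hp0 : 0 < p := by linarith
  have hp1 : 1 / p < 1 := by rw [div_lt_one hp0]; exact hp
  have hp2 : 0 < 1 / p := by positivity
  have hn : (0:ℝ) ≤ n := by positivity
  have h := fact_le n (1 - 1 / p) (by linarith) (by linarith)
  have hf : (0:ℝ) < n.factorial := by positivity
  have hA : 0 < Gamma (n + (1 - 1 / p)) := Gamma_pos_of_pos (by linarith)
  have hB : 0 < Gamma (n + 1 + (1 - 1 / p)) := Gamma_pos_of_pos (by linarith)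
  rw [show (n:ℝ) + 1 - 1 / p = n + (1 - 1 / p) by ring, div_rpow hA.le hf.le,
    div_le_div_iff₀ hB (by positivity)]
  have h2 := rpow_le_rpow hf.le h hp0.le
  rw [mul_rpow (by positivity) (by positivity), ← rpow_mul hA.le, ← rpow_mul hB.le,
    show (1 - (1 - 1 / p)) * p = 1 by field_simp; ring, show (1 - 1 / p) * p = p - 1 by field_simp, rpow_one] at h2
  rwa [rpow_sub_one hf.ne', mul_div_cancel₀ _ hf.ne']

/-- The finite Schur test. -/
lemma finite_ineq (p : ℝ) (hp : 1 < p) (a : ℕ → ℝ) (ha : ∀ m, 0 ≤ a m) (N M : ℕ) :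
    ∑ n ∈ Finset.range N, (∑ m ∈ Finset.range M, a m / ((m:ℝ) + n + 1)) ^ p ≤
      (π * (sin (π / p))⁻¹) ^ p * ∑ m ∈ Finset.range M, a m ^ p := by
  have hp0 : 0 < p := by linarith
  have hp1 : 1 / p < 1 := by rw [div_lt_one hp0]; exact hp
  have hp2 : 0 < 1 / p := by positivity
  set C := π * (sin (π / p))⁻¹ with hC
  have hC1 : C = π * (sin (π * (1 / p)))⁻¹ := by rw [hC]; ring_nf
  have hC2 : C = π * (sin (π * (1 - 1 / p)))⁻¹ := by
    rw [hC, show π * (1 - 1 / p) = π - π / p by ring, sin_pi_sub]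
  have hC0 : 0 < C := by
    have : 0 < sin (π / p) := sin_pos_of_pos_of_lt_pi (by positivity)
      (by rw [div_lt_iff₀ hp0]; nlinarith [pi_pos])
    positivity
  set W : ℕ → ℝ := fun m => Gamma (m + 1 - 1 / p) / m.factorial with hW
  set G : ℕ → ℝ := fun n => (n.factorial : ℝ) / Gamma (n + 1 + 1 / p) with hGdef
  have hW0 : ∀ m, 0 < W m := fun m => by
    have : 0 < Gamma ((m:ℝ) + 1 - 1 / p) := Gamma_pos_of_pos (by
      have : (0:ℝ) ≤ m := by positivity
      linarith)
    simp only [hW]; positivity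
  have hG0 : ∀ m, 0 < G m := fun m => by
    have : 0 < Gamma ((m:ℝ) + 1 + 1 / p) := Gamma_pos_of_pos (by positivity)
    simp only [hGdef]; positivity
  have step1 : ∀ n : ℕ, (∑ m ∈ Finset.range M, a m / ((m:ℝ) + n + 1)) ^ p ≤
      C ^ (p - 1) * (G n ^ (p - 1) *
        ∑ m ∈ Finset.range M, 1 / ((m:ℝ) + n + 1) * (a m ^ p / W m ^ (p - 1))) := by
    intro n
    have h := Real.inner_le_weight_mul_Lp_of_nonneg (Finset.range M) hp.le
      (fun m : ℕ => 1 / ((m:ℝ) + n + 1) * W m) (fun m => a m / W m)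
      (fun m => by have := hW0 m; positivity) (fun m => div_nonneg (ha m) (hW0 m).le)
    have hs := schur_sum M n (1 / p) hp2 hp1
    rw [← hC1] at hs
    have e1 : ∑ m ∈ Finset.range M, (1 / ((m:ℝ) + n + 1) * W m) * (a m / W m)
        = ∑ m ∈ Finset.range M, a m / ((m:ℝ) + n + 1) :=
      Finset.sum_congr rfl fun m _ => by have := (hW0 m).ne'; field_simp
    have e2 : ∑ m ∈ Finset.range M, (1 / ((m:ℝ) + n + 1) * W m) * (a m / W m) ^ p
        = ∑ m ∈ Finset.range M, 1 / ((m:ℝ) + n + 1) * (a m ^ p / W m ^ (p - 1)) :=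
      Finset.sum_congr rfl fun m _ => by
        have := (hW0 m).ne'
        have := rpow_pos_of_pos (hW0 m) p
        rw [div_rpow (ha m) (hW0 m).le, rpow_sub_one (hW0 m).ne']
        field_simp
    simp only [e1, e2] at h
    have n1 : 0 ≤ ∑ m ∈ Finset.range M, a m / ((m:ℝ) + n + 1) :=
      Finset.sum_nonneg fun m _ => div_nonneg (ha m) (by positivity)
    have n2 : 0 ≤ ∑ m ∈ Finset.range M, 1 / ((m:ℝ) + n + 1) * W m :=
      Finset.sum_nonneg fun m _ => by have := hW0 m; positivity
    have n3 : 0 ≤ ∑ m ∈ Finset.range M, 1 / ((m:ℝ) + n + 1) * (a m ^ p / W m ^ (p - 1)) :=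
      Finset.sum_nonneg fun m _ => by have := hW0 m; have := ha m; positivity
    have h2 := rpow_le_rpow n1 h hp0.le
    rw [mul_rpow (by positivity) (by positivity), ← rpow_mul n2, ← rpow_mul n3,
      inv_mul_cancel₀ hp0.ne', rpow_one, show (1 - p⁻¹) * p = p - 1 by field_simp] at h2
    refine h2.trans ?_
    rw [← mul_assoc, ← mul_rpow hC0.le (hG0 n).le]
    gcongr
  have step2 : ∀ m : ℕ, ∑ n ∈ Finset.range N, 1 / ((m:ℝ) + n + 1) * G n ^ (p - 1) ≤
      C * W m ^ (p - 1) := by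
    intro m
    have hs := schur_sum N m (1 - 1 / p) (by linarith) (by linarith)
    rw [← hC2] at hs
    calc _ ≤ ∑ n ∈ Finset.range N, 1 / ((n:ℝ) + m + 1) *
            (Gamma (n + 1 - (1 - 1 / p)) / n.factorial) := by
          refine Finset.sum_le_sum fun n _ => ?_
          rw [add_comm (m:ℝ) n]
          exact mul_le_mul_of_nonneg_left (wV p hp n) (by positivity)
      _ ≤ _ := hs
      _ ≤ _ := mul_le_mul_of_nonneg_left (wW p hp m) hC0.le
  calc _ ≤ ∑ n ∈ Finset.range N, C ^ (p - 1) * (G n ^ (p - 1) *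
        ∑ m ∈ Finset.range M, 1 / ((m:ℝ) + n + 1) * (a m ^ p / W m ^ (p - 1))) :=
        Finset.sum_le_sum fun n _ => step1 n
    _ = C ^ (p - 1) * ∑ m ∈ Finset.range M, (a m ^ p / W m ^ (p - 1)) *
          ∑ n ∈ Finset.range N, 1 / ((m:ℝ) + n + 1) * G n ^ (p - 1) := by
        rw [← Finset.mul_sum]
        congr 1
        simp only [Finset.mul_sum]
        rw [Finset.sum_comm]
        refine Finset.sum_congr rfl fun m _ => Finset.sum_congr rfl fun n _ => ?_
        ring
    _ ≤ C ^ (p - 1) * ∑ m ∈ Finset.range M, (a m ^ p / W m ^ (p - 1)) * (C * W m ^ (p - 1)) := by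
        gcongr with m _
        · have := ha m; have := hW0 m; positivity
        · exact step2 m
    _ = _ := by
        rw [Finset.mul_sum, Finset.mul_sum]
        refine Finset.sum_congr rfl fun m _ => ?_
        have := rpow_pos_of_pos (hW0 m) (p - 1)
        rw [rpow_sub_one hC0.ne']
        field_simp

end HilbertIneq

/-- **Hilbert's inequality.** Let `1 < p < ∞` and `1/p + 1/q = 1`. For every sequence
`a : ℕ → ℂ` with `∑ |a_m|^p < ∞`, one has
`∑_n |∑_m a_m/(m+n+1)|^p ≤ (π·csc(π/p))^p · ∑_m |a_m|^p`. -/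
theorem hilbert_inequality (p q : ℝ) (hp : 1 < p) (hpq : 1 / p + 1 / q = 1)
    (a : ℕ → ℂ) (ha : Summable fun m : ℕ => ‖a m‖ ^ p) :
    ∑' n : ℕ, ENNReal.ofReal (‖∑' m : ℕ, a m / ((m : ℂ) + (n : ℂ) + 1)‖ ^ p) ≤
      ENNReal.ofReal ((Real.pi * (Real.sin (Real.pi / p))⁻¹) ^ p) *
        ∑' m : ℕ, ENNReal.ofReal (‖a m‖ ^ p) := by
  have hp0 : 0 < p := by linarith
  have hC0 : 0 ≤ Real.pi * (Real.sin (Real.pi / p))⁻¹ := by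
    have : 0 < Real.sin (Real.pi / p) := Real.sin_pos_of_pos_of_lt_pi (by positivity)
      (by rw [div_lt_iff₀ hp0]; nlinarith [Real.pi_pos])
    positivity
  set C := Real.pi * (Real.sin (Real.pi / p))⁻¹ with hC
  rw [← ENNReal.ofReal_tsum_of_nonneg (fun m => by positivity) ha,
    ← ENNReal.ofReal_mul (by positivity)]
  refine ENNReal.tsum_le_of_sum_range_le fun N => ?_
  rw [← ENNReal.ofReal_sum_of_nonneg (fun n _ => by positivity)]
  refine ENNReal.ofReal_le_ofReal ?_
  -- partial sums in `m`
  have key : ∀ M, ∑ n ∈ Finset.range N,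
      ‖∑ m ∈ Finset.range M, a m / ((m : ℂ) + (n : ℂ) + 1)‖ ^ p ≤ C ^ p * ∑' m, ‖a m‖ ^ p := by
    intro M
    refine le_trans (Finset.sum_le_sum fun n _ => ?_)
      ((HilbertIneq.finite_ineq p hp (fun m => ‖a m‖) (fun m => norm_nonneg _) N M).trans
      (mul_le_mul_of_nonneg_left (ha.sum_le_tsum _ fun m _ => by positivity) (by positivity)))
    refine Real.rpow_le_rpow (norm_nonneg _) ((norm_sum_le _ _).trans (le_of_eq ?_)) hp0.le
    refine Finset.sum_congr rfl fun m _ => ?_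
    rw [norm_div]
    congr 1
    exact_mod_cast Complex.norm_natCast (m + n + 1)
  have hsum : ∀ n : ℕ, Summable fun m : ℕ => a m / ((m : ℂ) + (n : ℂ) + 1) := by
    intro n
    refine Summable.of_norm (summable_of_sum_range_le (c := (C ^ p * ∑' m, ‖a m‖ ^ p) ^ p⁻¹)
      (fun m => norm_nonneg _) fun M => ?_)
    have h := (HilbertIneq.finite_ineq p hp (fun m => ‖a m‖) (fun m => norm_nonneg _) (n + 1) M).trans
      (mul_le_mul_of_nonneg_left (ha.sum_le_tsum _ fun m _ => by positivity) (by positivity))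
    have h2 := (Finset.single_le_sum (f := fun n : ℕ =>
      (∑ m ∈ Finset.range M, ‖a m‖ / ((m:ℝ) + n + 1)) ^ p) (fun k _ => by positivity)
      (Finset.self_mem_range_succ n)).trans h
    have e : ∑ m ∈ Finset.range M, ‖a m / ((m : ℂ) + (n : ℂ) + 1)‖
        = ∑ m ∈ Finset.range M, ‖a m‖ / ((m:ℝ) + n + 1) := by
      refine Finset.sum_congr rfl fun m _ => ?_
      rw [norm_div]
      congr 1
      exact_mod_cast Complex.norm_natCast (m + n + 1)
    rw [e]
    have h3 := Real.rpow_le_rpow (by positivity) h2 (inv_nonneg.2 hp0.le)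
    rwa [Real.rpow_rpow_inv (by positivity) hp0.ne'] at h3
  refine le_of_tendsto' (x := Filter.atTop) (tendsto_finsetSum _ fun n _ => ?_) key
  exact ((hsum n).hasSum.tendsto_sum_nat.norm).rpow_const (Or.inr hp0.le)
end

section
/- Let μ be a positive finite Borel measure on (0,1). The operator H_μ is bounded on l^∞ (i.e., there is a constant M with sup_n |H_μ(a)(n)| ≤ M·sup_n |a_n| for all bounded sequences a) if and only if C_μ(∞) = ∫_{(0,1)} (1-t)^{-1} dμ(t) < ∞; moreover, when H_μ is bounded on l^∞, its operator norm equals C_μ(∞). -/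
open MeasureTheory Set

/-- The generalized Hilbert matrix operator `H_μ` induced by a measure `μ` on `(0,1)`:
`H_μ(a)(n) = ∑_m ∫_{(0,1)} C(n+m, m) t^m (1-t)^n a_m dμ(t)`. -/
noncomputable def Hmu (μ : Measure ℝ) (a : ℕ → ℂ) (n : ℕ) : ℂ :=
  ∑' m : ℕ, ∫ t in Ioo (0 : ℝ) 1, ((((n + m).choose m : ℝ)) * t ^ m * (1 - t) ^ n) • a m ∂μ

noncomputable def wHmu (μ : Measure ℝ) (n m : ℕ) : ℝ :=
  ∫ t in Ioo (0 : ℝ) 1, (((n + m).choose m : ℝ)) * t ^ m * (1 - t) ^ n ∂μ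

lemma kern_nonneg (n m : ℕ) (t : ℝ) (ht : t ∈ Ioo (0 : ℝ) 1) :
    0 ≤ (((n + m).choose m : ℝ)) * t ^ m * (1 - t) ^ n := by
  have h1 : 0 ≤ t := ht.1.le
  have h2 : 0 ≤ 1 - t := by linarith [ht.2]
  positivity

lemma kern_integrable (μ : Measure ℝ) [IsFiniteMeasure μ] (n m : ℕ) :
    IntegrableOn (fun t : ℝ => (((n + m).choose m : ℝ)) * t ^ m * (1 - t) ^ n) (Ioo 0 1) μ := by
  have hc : Continuous (fun t : ℝ => (((n + m).choose m : ℝ)) * t ^ m * (1 - t) ^ n) := by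
    fun_prop
  exact (hc.continuousOn.integrableOn_compact isCompact_Icc).mono_set Ioo_subset_Icc_self

lemma wHmu_nonneg (μ : Measure ℝ) (n m : ℕ) : 0 ≤ wHmu μ n m :=
  setIntegral_nonneg measurableSet_Ioo (fun t ht => kern_nonneg n m t ht)

lemma ofReal_wHmu (μ : Measure ℝ) [IsFiniteMeasure μ] (n m : ℕ) :
    ENNReal.ofReal (wHmu μ n m) = ∫⁻ t in Ioo (0 : ℝ) 1,
      ENNReal.ofReal ((((n + m).choose m : ℝ)) * t ^ m * (1 - t) ^ n) ∂μ := by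
  apply ofReal_integral_eq_lintegral_ofReal (kern_integrable μ n m)
  exact (ae_restrict_iff' measurableSet_Ioo).2 (Filter.Eventually.of_forall (kern_nonneg n m))

lemma kern_hasSum (n : ℕ) (t : ℝ) (ht : t ∈ Ioo (0 : ℝ) 1) :
    HasSum (fun m : ℕ => (((n + m).choose m : ℝ)) * t ^ m * (1 - t) ^ n) (1 - t)⁻¹ := by
  have h2 : 0 < 1 - t := by linarith [ht.2]
  have h := (hasSum_choose_mul_geometric_of_norm_lt_one (𝕜 := ℝ) n (r := t)
    (by rw [Real.norm_eq_abs, abs_of_pos ht.1]; exact ht.2)).mul_right ((1 - t) ^ n)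
  have e1 : (fun m : ℕ => (((n + m).choose m : ℝ)) * t ^ m * (1 - t) ^ n) =
      fun m : ℕ => (((m + n).choose n : ℝ)) * t ^ m * (1 - t) ^ n := by
    funext m
    rw [Nat.add_comm n m, Nat.choose_symm_add]
  have e2 : (1 - t)⁻¹ = 1 / (1 - t) ^ (n + 1) * (1 - t) ^ n := by
    field_simp
    ring
  rw [e1, e2]
  exact h

lemma tsum_wHmu (μ : Measure ℝ) [IsFiniteMeasure μ] (n : ℕ) :
    ∑' m, ENNReal.ofReal (wHmu μ n m) =
      ∫⁻ t in Ioo (0 : ℝ) 1, ENNReal.ofReal ((1 - t)⁻¹) ∂μ := by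
  simp_rw [ofReal_wHmu]
  rw [← lintegral_tsum (fun m => by fun_prop)]
  refine setLIntegral_congr_fun measurableSet_Ioo (fun t ht => ?_)
  have h := kern_hasSum n t ht
  rw [← h.tsum_eq, ENNReal.ofReal_tsum_of_nonneg (fun m => kern_nonneg n m t ht) h.summable]

lemma Hmu_eq (μ : Measure ℝ) (a : ℕ → ℂ) (n : ℕ) :
    Hmu μ a n = ∑' m, (wHmu μ n m) • a m := by
  unfold Hmu wHmu
  simp_rw [integral_smul_const]

lemma Hmu_upper (μ : Measure ℝ) [IsFiniteMeasure μ] (a : ℕ → ℂ) :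
    (⨆ n : ℕ, ENNReal.ofReal ‖Hmu μ a n‖) ≤
      (∫⁻ t in Ioo (0 : ℝ) 1, ENNReal.ofReal ((1 - t)⁻¹) ∂μ) *
        ⨆ n : ℕ, ENNReal.ofReal ‖a n‖ := by
  refine iSup_le fun n => ?_
  rw [Hmu_eq, ofReal_norm, ← tsum_wHmu μ n, ← ENNReal.tsum_mul_right]
  refine enorm_tsum_le_tsum_enorm.trans (ENNReal.tsum_le_tsum fun m => ?_)
  rw [enorm_smul, Real.enorm_of_nonneg (wHmu_nonneg μ n m), ← ofReal_norm (a m)]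
  gcongr
  exact le_iSup (fun n => ENNReal.ofReal ‖a n‖) m

lemma Hmu_lower (μ : Measure ℝ) [IsFiniteMeasure μ] (M : ℝ)
    (h : ∀ a : ℕ → ℂ, (⨆ n : ℕ, ENNReal.ofReal ‖a n‖) ≠ ⊤ →
        (⨆ n : ℕ, ENNReal.ofReal ‖Hmu μ a n‖) ≤
          ENNReal.ofReal M * ⨆ n : ℕ, ENNReal.ofReal ‖a n‖) :
    (∫⁻ t in Ioo (0 : ℝ) 1, ENNReal.ofReal ((1 - t)⁻¹) ∂μ) ≤ ENNReal.ofReal M := by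
  rw [← tsum_wHmu μ 0]
  refine ENNReal.tsum_le_of_sum_range_le fun N => ?_
  let a : ℕ → ℂ := fun m => if m < N then 1 else 0
  have ha : (⨆ n : ℕ, ENNReal.ofReal ‖a n‖) ≤ 1 := by
    refine iSup_le fun n => ?_
    by_cases hn : n < N <;> simp [a, hn]
  have hH : Hmu μ a 0 = ((∑ m ∈ Finset.range N, wHmu μ 0 m : ℝ) : ℂ) := by
    rw [Hmu_eq, tsum_eq_sum (s := Finset.range N)]
    · push_cast
      refine Finset.sum_congr rfl fun m hm => ?_
      simp [a, Finset.mem_range.1 hm]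
    · intro m hm
      have : ¬ m < N := by simpa using hm
      simp [a, this]
  have hs : 0 ≤ ∑ m ∈ Finset.range N, wHmu μ 0 m :=
    Finset.sum_nonneg fun m _ => wHmu_nonneg μ 0 m
  have h1 := (le_iSup (fun n => ENNReal.ofReal ‖Hmu μ a n‖) 0).trans
    (h a (ne_top_of_le_ne_top ENNReal.one_ne_top ha))
  simp only [hH, Complex.norm_real, Real.norm_of_nonneg hs] at h1
  rw [ENNReal.ofReal_sum_of_nonneg (fun m _ => wHmu_nonneg μ 0 m)] at h1
  calc _ ≤ _ := h1
    _ ≤ ENNReal.ofReal M * 1 := by gcongr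
    _ = _ := mul_one _

/-- `H_μ` is bounded on `ℓ^∞` iff `C_μ(∞) = ∫_{(0,1)} (1-t)^{-1} dμ(t) < ∞`, and in that
case the operator norm (the least bound `M`) equals `C_μ(∞)`. -/
theorem Hmu_bounded_linfty_iff (μ : Measure ℝ) [IsFiniteMeasure μ] :
    ((∃ M : ℝ, 0 ≤ M ∧ ∀ a : ℕ → ℂ, (⨆ n : ℕ, ENNReal.ofReal ‖a n‖) ≠ ⊤ →
        (⨆ n : ℕ, ENNReal.ofReal ‖Hmu μ a n‖) ≤
          ENNReal.ofReal M * ⨆ n : ℕ, ENNReal.ofReal ‖a n‖) ↔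
      (∫⁻ t in Ioo (0 : ℝ) 1, ENNReal.ofReal ((1 - t)⁻¹) ∂μ) ≠ ⊤) ∧
    ((∃ M : ℝ, 0 ≤ M ∧ ∀ a : ℕ → ℂ, (⨆ n : ℕ, ENNReal.ofReal ‖a n‖) ≠ ⊤ →
        (⨆ n : ℕ, ENNReal.ofReal ‖Hmu μ a n‖) ≤
          ENNReal.ofReal M * ⨆ n : ℕ, ENNReal.ofReal ‖a n‖) →
      IsLeast {M : ℝ | 0 ≤ M ∧ ∀ a : ℕ → ℂ, (⨆ n : ℕ, ENNReal.ofReal ‖a n‖) ≠ ⊤ →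
          (⨆ n : ℕ, ENNReal.ofReal ‖Hmu μ a n‖) ≤
            ENNReal.ofReal M * ⨆ n : ℕ, ENNReal.ofReal ‖a n‖}
        (∫⁻ t in Ioo (0 : ℝ) 1, ENNReal.ofReal ((1 - t)⁻¹) ∂μ).toReal) := by
  refine ⟨⟨?_, ?_⟩, ?_⟩
  · rintro ⟨M, _, h⟩
    exact ne_top_of_le_ne_top ENNReal.ofReal_ne_top (Hmu_lower μ M h)
  · intro hC
    refine ⟨(∫⁻ t in Ioo (0 : ℝ) 1, ENNReal.ofReal ((1 - t)⁻¹) ∂μ).toReal,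
      ENNReal.toReal_nonneg, fun a _ => ?_⟩
    rw [ENNReal.ofReal_toReal hC]
    exact Hmu_upper μ a
  · rintro ⟨M, _, h⟩
    have hC := ne_top_of_le_ne_top ENNReal.ofReal_ne_top (Hmu_lower μ M h)
    refine ⟨⟨ENNReal.toReal_nonneg, fun a _ => ?_⟩, ?_⟩
    · rw [ENNReal.ofReal_toReal hC]
      exact Hmu_upper μ a
    · rintro M' ⟨hM', h'⟩
      exact ENNReal.toReal_le_of_le_ofReal hM' (Hmu_lower μ M' h')
end

section
/- Let μ be a positive finite Borel measure on (0,1) and let α, β > -1 with β - α > -1. Then H_μ^{α,β} is bounded from l^∞_{w̄₁} into l^∞_{w̄₂} if and only if C_μ(β,∞) = ∫_{(0,1)} (1-t)^{-β-1} dμ(t) < ∞. Moreover, when H_μ^{α,β} : l^∞_{w̄₁} → l^∞_{w̄₂} is bounded, its operator norm equals C_μ(β,∞). -/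
open MeasureTheory Set

/-- `(γ+1)_s = Γ(γ+s+1)/Γ(γ+1)`. -/
noncomputable def poch (γ s : ℝ) : ℝ := Real.Gamma (γ + s + 1) / Real.Gamma (γ + 1)

/-- `k_{α,β}(m,n) = Γ(n+m+β+1)/(Γ(m+α+1)Γ(n+β-α+1))`. -/
noncomputable def kker (α β : ℝ) (m n : ℕ) : ℝ :=
  Real.Gamma ((n : ℝ) + (m : ℝ) + β + 1) /
    (Real.Gamma ((m : ℝ) + α + 1) * Real.Gamma ((n : ℝ) + β - α + 1))

/-- The operator `H_μ^{α,β}(a)(n) = ∑_m ∫_{(0,1)} k_{α,β}(m,n) t^m (1-t)^n a_m dμ(t)`. -/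
noncomputable def Hab (μ : Measure ℝ) (α β : ℝ) (a : ℕ → ℂ) (n : ℕ) : ℂ :=
  ∑' m : ℕ, ∫ t in Ioo (0 : ℝ) 1, (kker α β m n * t ^ m * (1 - t) ^ n) • a m ∂μ

/-- The weight `w̄₁(m) = (m+1)_α^{-1}`. -/
noncomputable def wb1 (α : ℝ) (m : ℕ) : ℝ := (poch (m : ℝ) α)⁻¹

/-- The weight `w̄₂(m) = (m+β-α+1)_α^{-1}`. -/
noncomputable def wb2 (α β : ℝ) (m : ℕ) : ℝ := (poch ((m : ℝ) + β - α) α)⁻¹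

lemma gamma_asc (s : ℝ) (hs : 0 < s) (m : ℕ) :
    Real.Gamma (s + m) = (ascPochhammer ℝ m).eval s * Real.Gamma s := by
  induction m with
  | zero => simp
  | succ k ih =>
    have h : s + (k : ℝ) ≠ 0 := by positivity
    rw [ascPochhammer_succ_eval]
    push_cast
    rw [← add_assoc, Real.Gamma_add_one h, ih]
    ring

lemma choose_gamma (s : ℝ) (hs : 0 < s) (m : ℕ) :
    Ring.choose (s + m - 1) m = Real.Gamma (s + m) / (m.factorial * Real.Gamma s) := by
  have h1 := Ring.descPochhammer_eq_factorial_smul_choose (s + m - 1) m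
  rw [Polynomial.descPochhammer_smeval_eq_ascPochhammer,
    Polynomial.ascPochhammer_smeval_eq_eval, nsmul_eq_mul] at h1
  have h2 : s + (m : ℝ) - 1 - m + 1 = s := by ring
  rw [h2] at h1
  have hG : Real.Gamma s ≠ 0 := (Real.Gamma_pos_of_pos hs).ne'
  have hf : (m.factorial : ℝ) ≠ 0 := by positivity
  rw [gamma_asc s hs, h1]
  field_simp

lemma negbin (s t : ℝ) (hs : 0 < s) (ht0 : 0 < t) (ht1 : t < 1) :
    HasSum (fun m : ℕ => Real.Gamma (s + m) / (m.factorial * Real.Gamma s) * t ^ m)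
      ((1 - t) ^ (-s)) := by
  have h := (Real.one_div_one_sub_rpow_hasFPowerSeriesOnBall_zero s).hasSum (y := t)
    (by simp [abs_of_pos ht0, ← ofReal_norm, ht1])
  simp only [zero_add] at h
  rw [Real.rpow_neg (by linarith), ← one_div]
  refine (congrArg (fun f : ℕ → ℝ => HasSum f (1 / (1 - t) ^ s)) ?_).mpr h
  funext m
  simp [FormalMultilinearSeries.ofScalars, choose_gamma s hs, List.ofFn_const]

/-- normalized coefficient -/
noncomputable def cc (α β : ℝ) (m n : ℕ) : ℝ := wb2 α β n * kker α β m n * poch m α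

lemma poch_pos' {γ s : ℝ} (h1 : 0 < γ + 1) (h2 : 0 < γ + s + 1) : 0 < poch γ s :=
  div_pos (Real.Gamma_pos_of_pos h2) (Real.Gamma_pos_of_pos h1)

lemma poch_nat_pos {α : ℝ} (hα : -1 < α) (m : ℕ) : 0 < poch (m : ℝ) α := by
  have : (0 : ℝ) ≤ m := by positivity
  exact poch_pos' (by linarith) (by linarith)

lemma wb2_pos {α β : ℝ} (hβ : -1 < β) (hβα : -1 < β - α) (n : ℕ) : 0 < wb2 α β n := by
  have : (0 : ℝ) ≤ n := by positivity
  exact inv_pos.2 (poch_pos' (by linarith) (by linarith))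

lemma kker_pos {α β : ℝ} (hα : -1 < α) (hβ : -1 < β) (hβα : -1 < β - α) (m n : ℕ) : 0 < kker α β m n := by
  have : (0 : ℝ) ≤ n := by positivity
  have : (0 : ℝ) ≤ m := by positivity
  exact div_pos (Real.Gamma_pos_of_pos (by linarith))
    (mul_pos (Real.Gamma_pos_of_pos (by linarith)) (Real.Gamma_pos_of_pos (by linarith)))

lemma cc_pos {α β : ℝ} (hα : -1 < α) (hβ : -1 < β) (hβα : -1 < β - α) (m n : ℕ) : 0 < cc α β m n :=
  mul_pos (mul_pos (wb2_pos hβ hβα n) (kker_pos hα hβ hβα m n)) (poch_nat_pos hα m)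

lemma cc_eq {α β : ℝ} (hα : -1 < α) (hβ : -1 < β) (hβα : -1 < β - α) (m n : ℕ) : cc α β m n =
    Real.Gamma ((n + β + 1) + m) / (m.factorial * Real.Gamma (n + β + 1)) := by
  have hn : (0 : ℝ) ≤ n := by positivity
  have hm : (0 : ℝ) ≤ m := by positivity
  have h1 : Real.Gamma (m + α + 1) ≠ 0 := (Real.Gamma_pos_of_pos (by linarith)).ne'
  have h2 : Real.Gamma (n + β - α + 1) ≠ 0 := (Real.Gamma_pos_of_pos (by linarith)).ne'
  have h3 : Real.Gamma (n + β + 1) ≠ 0 := (Real.Gamma_pos_of_pos (by linarith)).ne'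
  have hf : (m.factorial : ℝ) ≠ 0 := by positivity
  have e1 : (n : ℝ) + β - α + α + 1 = n + β + 1 := by ring
  have e2 : (n : ℝ) + m + β + 1 = n + β + 1 + m := by ring
  unfold cc wb2 kker poch
  rw [e1, e2, Real.Gamma_nat_eq_factorial]
  field_simp

lemma key_sum {α β : ℝ} (hα : -1 < α) (hβ : -1 < β) (hβα : -1 < β - α) (n : ℕ) {t : ℝ} (ht : t ∈ Ioo (0 : ℝ) 1) :
    ∑' m : ℕ, ENNReal.ofReal (cc α β m n * t ^ m * (1 - t) ^ n) =
      ENNReal.ofReal ((1 - t) ^ (-β - 1)) := by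
  have hn : (0 : ℝ) ≤ n := by positivity
  have h1t : 0 < 1 - t := by linarith [ht.2]
  have h := (negbin (n + β + 1) t (by linarith) ht.1 ht.2).mul_right ((1 - t) ^ n)
  simp only [← cc_eq hα hβ hβα] at h
  rw [← Real.rpow_natCast, ← Real.rpow_add h1t] at h
  have e : -((n : ℝ) + β + 1) + n = -β - 1 := by ring
  rw [e] at h
  simp only [Real.rpow_natCast] at h
  rw [← h.tsum_eq, ENNReal.ofReal_tsum_of_nonneg _ h.summable]
  intro m
  have := cc_pos hα hβ hβα m n
  have := ht.1
  positivity

lemma key_int {α β : ℝ} (hα : -1 < α) (hβ : -1 < β) (hβα : -1 < β - α) (μ : Measure ℝ) (n : ℕ) :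
    ∑' m : ℕ, ∫⁻ t in Ioo (0 : ℝ) 1, ENNReal.ofReal (cc α β m n * t ^ m * (1 - t) ^ n) ∂μ =
      ∫⁻ t in Ioo (0 : ℝ) 1, ENNReal.ofReal ((1 - t) ^ (-β - 1)) ∂μ := by
  rw [← lintegral_tsum (fun m => by fun_prop)]
  exact setLIntegral_congr_fun measurableSet_Ioo (fun t ht => key_sum hα hβ hβα n ht)

lemma upper {α β : ℝ} (hα : -1 < α) (hβ : -1 < β) (hβα : -1 < β - α) (μ : Measure ℝ) (a : ℕ → ℂ) (n : ℕ) :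
    ENNReal.ofReal (wb2 α β n * ‖Hab μ α β a n‖) ≤
      (∫⁻ t in Ioo (0 : ℝ) 1, ENNReal.ofReal ((1 - t) ^ (-β - 1)) ∂μ) *
        ⨆ n : ℕ, ENNReal.ofReal (wb1 α n * ‖a n‖) := by
  set A := ⨆ n : ℕ, ENNReal.ofReal (wb1 α n * ‖a n‖) with hA
  have hw := wb2_pos hβ hβα n
  have hbd : ∀ m, ENNReal.ofReal ‖a m‖ ≤ ENNReal.ofReal (poch m α) * A := by
    intro m
    have hp := poch_nat_pos hα m
    have : ‖a m‖ = poch m α * (wb1 α m * ‖a m‖) := by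
      unfold wb1; field_simp
    rw [this, ENNReal.ofReal_mul hp.le]
    gcongr
    exact le_iSup (fun n : ℕ => ENNReal.ofReal (wb1 α n * ‖a n‖)) m
  rw [← key_int hα hβ hβα μ n, ← ENNReal.tsum_mul_right, ENNReal.ofReal_mul hw.le,
    ofReal_norm]
  unfold Hab
  refine (mul_le_mul_right enorm_tsum_le_tsum_enorm _).trans ?_
  rw [← ENNReal.tsum_mul_left]
  refine ENNReal.tsum_le_tsum fun m => ?_
  refine (mul_le_mul_right (enorm_integral_le_lintegral_enorm _) _).trans ?_
  rw [← lintegral_const_mul' _ _ ENNReal.ofReal_ne_top, ← lintegral_mul_const _ (by fun_prop)]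
  refine setLIntegral_mono' measurableSet_Ioo fun t ht => ?_
  have h1t : 0 < 1 - t := by linarith [ht.2]
  have ht0 := ht.1
  have hk := kker_pos hα hβ hβα m n
  have hp := poch_nat_pos hα m
  have hq : 0 ≤ kker α β m n * t ^ m * (1 - t) ^ n := by positivity
  rw [enorm_smul, Real.enorm_eq_ofReal hq, ← ofReal_norm]
  have e : cc α β m n * t ^ m * (1 - t) ^ n =
      wb2 α β n * ((kker α β m n * t ^ m * (1 - t) ^ n) * poch m α) := by
    unfold cc; ring
  rw [e, ENNReal.ofReal_mul hw.le, ENNReal.ofReal_mul hq]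
  calc _ ≤ ENNReal.ofReal (wb2 α β n) * (ENNReal.ofReal (kker α β m n * t ^ m * (1 - t) ^ n) *
        (ENNReal.ofReal (poch m α) * A)) :=
        mul_le_mul_right (mul_le_mul_right (hbd m) _) _
    _ = _ := by ring

lemma lower {α β : ℝ} (hα : -1 < α) (hβ : -1 < β) (hβα : -1 < β - α) (μ : Measure ℝ) [IsFiniteMeasure μ] (M : ℝ)
    (h : ∀ a : ℕ → ℂ,
        (⨆ n : ℕ, ENNReal.ofReal (wb1 α n * ‖a n‖)) ≠ ⊤ →
        (⨆ n : ℕ, ENNReal.ofReal (wb2 α β n * ‖Hab μ α β a n‖)) ≤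
          ENNReal.ofReal M * ⨆ n : ℕ, ENNReal.ofReal (wb1 α n * ‖a n‖)) :
    (∫⁻ t in Ioo (0 : ℝ) 1, ENNReal.ofReal ((1 - t) ^ (-β - 1)) ∂μ) ≤ ENNReal.ofReal M := by
  rw [← key_int hα hβ hβα μ 0]
  refine ENNReal.tsum_le_of_sum_range_le fun N => ?_
  let a : ℕ → ℂ := fun m => if m < N then ((poch m α : ℝ) : ℂ) else 0
  have ha : (⨆ n : ℕ, ENNReal.ofReal (wb1 α n * ‖a n‖)) ≤ 1 := by
    refine iSup_le fun m => ?_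
    have hp := poch_nat_pos hα m
    rw [← ENNReal.ofReal_one]
    refine ENNReal.ofReal_le_ofReal ?_
    by_cases hm : m < N
    · simp only [a, hm, if_true, wb1, Complex.norm_real, Real.norm_eq_abs, abs_of_pos hp]
      rw [inv_mul_cancel₀ hp.ne']
    · simp [a, hm]
  have h1 := h a (ne_top_of_le_ne_top ENNReal.one_ne_top ha)
  have h2 := (le_iSup (fun n : ℕ => ENNReal.ofReal (wb2 α β n * ‖Hab μ α β a n‖)) 0).trans
    (h1.trans (mul_le_mul_right ha _))
  rw [mul_one] at h2
  refine le_trans (le_of_eq ?_) h2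
  have hw := wb2_pos hβ hβα 0
  have hint : ∀ c : ℝ, ∀ m : ℕ,
      Integrable (fun t : ℝ => c * t ^ m * (1 - t) ^ 0) (μ.restrict (Ioo (0 : ℝ) 1)) := by
    intro c m
    refine Integrable.of_bound (by fun_prop) |c| ?_
    filter_upwards [ae_restrict_mem measurableSet_Ioo] with t ht
    have : |t ^ m| ≤ 1 := by
      rw [abs_of_nonneg (pow_nonneg ht.1.le _)]
      exact pow_le_one₀ ht.1.le ht.2.le
    simp only [pow_zero, mul_one, Real.norm_eq_abs, abs_mul]
    exact mul_le_of_le_one_right (abs_nonneg _) this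
  have hnn : ∀ c : ℝ, 0 ≤ c → ∀ m : ℕ,
      0 ≤ᵐ[μ.restrict (Ioo (0 : ℝ) 1)] (fun t : ℝ => c * t ^ m * (1 - t) ^ 0) := by
    intro c hc m
    filter_upwards [ae_restrict_mem measurableSet_Ioo] with t ht
    have := ht.1
    simp only [Pi.zero_apply, pow_zero, mul_one]
    positivity
  have hH : Hab μ α β a 0 = ((∑ m ∈ Finset.range N,
      (∫ t in Ioo (0 : ℝ) 1, kker α β m 0 * t ^ m * (1 - t) ^ 0 ∂μ) * poch m α : ℝ) : ℂ) := by
    unfold Hab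
    rw [tsum_eq_sum (s := Finset.range N)]
    · push_cast
      refine Finset.sum_congr rfl fun m hm => ?_
      rw [integral_smul_const]
      simp [a, Finset.mem_range.1 hm]
    · intro m hm
      rw [Finset.mem_range] at hm
      simp [a, hm]
  have hnonneg : ∀ m, 0 ≤
      (∫ t in Ioo (0 : ℝ) 1, kker α β m 0 * t ^ m * (1 - t) ^ 0 ∂μ) * poch m α := fun m =>
    mul_nonneg (integral_nonneg_of_ae (hnn _ (kker_pos hα hβ hβα m 0).le m))
      (poch_nat_pos hα m).le
  rw [hH, Complex.norm_real, Real.norm_eq_abs,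
    abs_of_nonneg (Finset.sum_nonneg fun m _ => hnonneg m), Finset.mul_sum,
    ENNReal.ofReal_sum_of_nonneg (fun m _ => mul_nonneg hw.le (hnonneg m))]
  refine Finset.sum_congr rfl fun m _ => ?_
  rw [← ofReal_integral_eq_lintegral_ofReal (hint _ m) (hnn _ (cc_pos hα hβ hβα m 0).le m)]
  congr 1
  rw [← integral_mul_const, ← integral_const_mul]
  congr 1
  ext t
  unfold cc
  ring

/-- `H_μ^{α,β}` is bounded from `ℓ^∞_{w̄₁}` into `ℓ^∞_{w̄₂}` iff
`C_μ(β,∞) = ∫_{(0,1)} (1-t)^{-β-1} dμ(t) < ∞`, and in that case the operator norm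
(the least bound `M`) equals `C_μ(β,∞)`. -/
theorem Hab_bounded_linfty_iff (μ : Measure ℝ) [IsFiniteMeasure μ] (α β : ℝ)
    (hα : -1 < α) (hβ : -1 < β) (hβα : -1 < β - α) :
    ((∃ M : ℝ, 0 ≤ M ∧ ∀ a : ℕ → ℂ,
        (⨆ n : ℕ, ENNReal.ofReal (wb1 α n * ‖a n‖)) ≠ ⊤ →
        (⨆ n : ℕ, ENNReal.ofReal (wb2 α β n * ‖Hab μ α β a n‖)) ≤
          ENNReal.ofReal M * ⨆ n : ℕ, ENNReal.ofReal (wb1 α n * ‖a n‖)) ↔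
      (∫⁻ t in Ioo (0 : ℝ) 1, ENNReal.ofReal ((1 - t) ^ (-β - 1)) ∂μ) ≠ ⊤) ∧
    ((∃ M : ℝ, 0 ≤ M ∧ ∀ a : ℕ → ℂ,
        (⨆ n : ℕ, ENNReal.ofReal (wb1 α n * ‖a n‖)) ≠ ⊤ →
        (⨆ n : ℕ, ENNReal.ofReal (wb2 α β n * ‖Hab μ α β a n‖)) ≤
          ENNReal.ofReal M * ⨆ n : ℕ, ENNReal.ofReal (wb1 α n * ‖a n‖)) →
      IsLeast {M : ℝ | 0 ≤ M ∧ ∀ a : ℕ → ℂ,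
          (⨆ n : ℕ, ENNReal.ofReal (wb1 α n * ‖a n‖)) ≠ ⊤ →
          (⨆ n : ℕ, ENNReal.ofReal (wb2 α β n * ‖Hab μ α β a n‖)) ≤
            ENNReal.ofReal M * ⨆ n : ℕ, ENNReal.ofReal (wb1 α n * ‖a n‖)}
        (∫⁻ t in Ioo (0 : ℝ) 1, ENNReal.ofReal ((1 - t) ^ (-β - 1)) ∂μ).toReal) := by
  have hup : (∫⁻ t in Ioo (0 : ℝ) 1, ENNReal.ofReal ((1 - t) ^ (-β - 1)) ∂μ) ≠ ⊤ →
      ∀ a : ℕ → ℂ,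
        (⨆ n : ℕ, ENNReal.ofReal (wb1 α n * ‖a n‖)) ≠ ⊤ →
        (⨆ n : ℕ, ENNReal.ofReal (wb2 α β n * ‖Hab μ α β a n‖)) ≤
          ENNReal.ofReal
            (∫⁻ t in Ioo (0 : ℝ) 1, ENNReal.ofReal ((1 - t) ^ (-β - 1)) ∂μ).toReal *
            ⨆ n : ℕ, ENNReal.ofReal (wb1 α n * ‖a n‖) := by
    intro hC a _
    rw [ENNReal.ofReal_toReal hC]
    exact iSup_le fun n => upper hα hβ hβα μ a n
  have hfin : ∀ M : ℝ, (∫⁻ t in Ioo (0 : ℝ) 1, ENNReal.ofReal ((1 - t) ^ (-β - 1)) ∂μ) ≤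
      ENNReal.ofReal M →
      (∫⁻ t in Ioo (0 : ℝ) 1, ENNReal.ofReal ((1 - t) ^ (-β - 1)) ∂μ) ≠ ⊤ :=
    fun M h => ne_top_of_le_ne_top ENNReal.ofReal_ne_top h
  refine ⟨⟨?_, ?_⟩, ?_⟩
  · rintro ⟨M, _, h⟩
    exact hfin M (lower hα hβ hβα μ M h)
  · intro hC
    exact ⟨_, ENNReal.toReal_nonneg, hup hC⟩
  · rintro ⟨M, _, h⟩
    refine ⟨⟨ENNReal.toReal_nonneg, hup (hfin M (lower hα hβ hβα μ M h))⟩, ?_⟩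
    rintro M' ⟨hM', h'⟩
    exact ENNReal.toReal_le_of_le_ofReal hM' (lower hα hβ hβα μ M' h')
end

section
/- Let μ be a positive finite Borel measure on (0,1), let β > -1 and let 1 ≤ p < ∞. Then H_μ^β is bounded on l^p_w with weight w(m) = (m+1)_β if and only if C_μ(β,p) = ∫_{(0,1)} (1-t)^{-(1-1/p)(β+1)} t^{-(β+1)/p} dμ(t) < ∞. Moreover, when H_μ^β is bounded on l^p_w, its operator norm equals C_μ(β,p). -/
open MeasureTheory Set

/-- The generalized binomial coefficient `binom(γ, m) = γ(γ-1)⋯(γ-m+1)/m!`. -/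
noncomputable def gbinom (γ : ℝ) (m : ℕ) : ℝ :=
  (∏ i ∈ Finset.range m, (γ - (i : ℝ))) / (m.factorial : ℝ)

/-- The operator `H_μ^β(a)(n) = ∑_m ∫_{(0,1)} binom(n+m+β, m) t^m (1-t)^n a_m dμ(t)`. -/
noncomputable def Hb (μ : Measure ℝ) (β : ℝ) (a : ℕ → ℂ) (n : ℕ) : ℂ :=
  ∑' m : ℕ,
    ∫ t in Ioo (0 : ℝ) 1, (gbinom ((n : ℝ) + (m : ℝ) + β) m * t ^ m * (1 - t) ^ n) • a m ∂μ


open Filter Topology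
open scoped ENNReal

lemma gbinom_pos {x : ℝ} (hx : 0 < x + 1) (m : ℕ) : 0 < gbinom (x + m) m := by
  unfold gbinom
  apply div_pos _ (by positivity)
  apply Finset.prod_pos
  intro i hi
  have : (i : ℝ) + 1 ≤ m := by exact_mod_cast Finset.mem_range.1 hi
  linarith

lemma gbinom_succ (x : ℝ) (m : ℕ) :
    (m + 1) * gbinom (x + (m + 1 : ℕ)) (m + 1) = (x + m + 1) * gbinom (x + m) m := by
  unfold gbinom
  rw [Finset.prod_range_succ', Nat.factorial_succ]
  push_cast
  have : ∀ k : ℕ, x + (m + 1) - ((k : ℝ) + 1) = x + m - k := fun k => by ring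
  simp only [this]
  have h1 : (m : ℝ) + 1 ≠ 0 := by positivity
  have h2 : (m.factorial : ℝ) ≠ 0 := by positivity
  field_simp
  ring

lemma gbinom_succ_shift (x : ℝ) (m : ℕ) :
    (m + 1) * gbinom (x + (m + 1 : ℕ)) (m + 1) = (x + 1) * gbinom (x + 1 + m) m := by
  unfold gbinom
  rw [Finset.prod_range_succ, Nat.factorial_succ]
  push_cast
  have : ∀ k : ℕ, x + (m + 1) - (k : ℝ) = x + 1 + m - k := fun k => by ring
  simp only [this]
  have h1 : (m : ℝ) + 1 ≠ 0 := by positivity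
  have h2 : (m.factorial : ℝ) ≠ 0 := by positivity
  field_simp
  ring

lemma gbinom_gamma {x : ℝ} (hx : 0 < x + 1) (m : ℕ) :
    gbinom (x + m) m = Real.Gamma (x + m + 1) / (Real.Gamma (x + 1) * m.factorial) := by
  induction m with
  | zero =>
    have := (Real.Gamma_pos_of_pos hx).ne'
    simp [gbinom, this]
  | succ k ih =>
    have h := gbinom_succ x k
    rw [ih] at h
    have h1 : (k : ℝ) + 1 ≠ 0 := by positivity
    have h2 : (k.factorial : ℝ) ≠ 0 := by positivity
    have h3 := (Real.Gamma_pos_of_pos hx).ne'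
    have h4 : Real.Gamma (x + (k + 1 : ℕ) + 1) = (x + k + 1) * Real.Gamma (x + k + 1) := by
      rw [← Real.Gamma_add_one (by have : (0:ℝ) ≤ k := k.cast_nonneg
                                   linarith)]; congr 1; push_cast; ring
    rw [h4, Nat.factorial_succ]
    push_cast at h ⊢
    field_simp at h ⊢
    linarith

lemma poch_pos'_s5 {β : ℝ} (hβ : -1 < β) (n : ℕ) : 0 < poch n β := by
  unfold poch
  have : (0:ℝ) ≤ n := n.cast_nonneg
  exact div_pos (Real.Gamma_pos_of_pos (by linarith)) (Real.Gamma_pos_of_pos (by linarith))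

lemma poch_symm {β : ℝ} (hβ : -1 < β) (n m : ℕ) :
    poch n β * gbinom (n + m + β) m = poch m β * gbinom (m + n + β) n := by
  have hn : (0:ℝ) ≤ n := n.cast_nonneg
  have hm : (0:ℝ) ≤ m := m.cast_nonneg
  have e1 : (n : ℝ) + m + β = (n + β) + m := by ring
  have e2 : (m : ℝ) + n + β = (m + β) + n := by ring
  rw [e1, e2, gbinom_gamma (by linarith), gbinom_gamma (by linarith)]
  unfold poch
  have h3 := (Real.Gamma_pos_of_pos (show 0 < (n : ℝ) + β + 1 by linarith)).ne'
  have h4 := (Real.Gamma_pos_of_pos (show 0 < (m : ℝ) + β + 1 by linarith)).ne'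
  rw [Real.Gamma_nat_eq_factorial, Real.Gamma_nat_eq_factorial]
  have : (n : ℝ) + β + m + 1 = m + β + n + 1 := by ring
  rw [this]
  field_simp

lemma choose_eq_gbinom (x : ℝ) (m : ℕ) : Ring.choose x m = gbinom x m := by
  have h := Ring.descPochhammer_eq_factorial_smul_choose x m
  rw [← Polynomial.aeval_eq_smeval, Polynomial.aeval_def, Polynomial.eval₂_eq_eval_map, descPochhammer_map,
    descPochhammer_eval_eq_prod_range, nsmul_eq_mul] at h
  unfold gbinom
  rw [h]
  field_simp

lemma hasSum_gbinom (x : ℝ) {t : ℝ} (ht0 : 0 < t) (ht1 : t < 1) :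
    HasSum (fun m : ℕ => gbinom (x + m) m * t ^ m) ((1 - t) ^ (-(x + 1))) := by
  have h := (Real.one_div_one_sub_rpow_hasFPowerSeriesOnBall_zero (x + 1)).hasSum
    (y := t) (by simp [Metric.mem_eball, edist_dist, abs_of_pos ht0, ht1])
  simp only [FormalMultilinearSeries.ofScalars_apply_eq, zero_add, choose_eq_gbinom] at h
  rw [Real.rpow_neg (by linarith), ← one_div]
  refine h.congr_fun fun m => ?_
  have : x + 1 + m - 1 = x + m := by ring
  rw [this, smul_eq_mul]

lemma hasSum_kernel {β : ℝ} (n : ℕ) {t : ℝ} (ht0 : 0 < t) (ht1 : t < 1) :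
    HasSum (fun m : ℕ => gbinom (n + m + β) m * t ^ m * (1 - t) ^ n) ((1 - t) ^ (-(β + 1))) := by
  have h := (hasSum_gbinom (n + β) ht0 ht1).mul_right ((1 - t) ^ n)
  have e : (1 - t) ^ (-((n : ℝ) + β + 1)) * (1 - t) ^ n = (1 - t) ^ (-(β + 1)) := by
    rw [← Real.rpow_natCast, ← Real.rpow_add (by linarith)]; congr 1; ring
  rw [e] at h
  refine h.congr_fun fun m => ?_
  have e1 : (n : ℝ) + m + β = n + β + m := by ring
  rw [e1]

lemma hasSum_kernel_mean {β : ℝ} (n : ℕ) {t : ℝ} (ht0 : 0 < t) (ht1 : t < 1) :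
    HasSum (fun m : ℕ => (m : ℝ) * (gbinom (n + m + β) m * t ^ m * (1 - t) ^ n))
      ((1 - t) ^ (-(β + 1)) * (t * (n + β + 1) / (1 - t))) := by
  rw [← hasSum_nat_add_iff' 1]
  simp only [Finset.range_one, Finset.sum_singleton, Nat.cast_zero, zero_mul, sub_zero]
  have h := ((hasSum_gbinom (n + β + 1) ht0 ht1).mul_right ((1 - t) ^ n)).mul_left (t * (n + β + 1))
  have h0 : 0 < 1 - t := by linarith
  have e : (1 - t) ^ (-((n : ℝ) + β + 1 + 1)) * (1 - t) ^ n = (1 - t) ^ (-(β + 1)) / (1 - t) := by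
    rw [← Real.rpow_natCast, ← Real.rpow_add (by linarith)]
    rw [← Real.rpow_sub_one h0.ne']; congr 1; ring
  rw [e] at h
  have e2 : (1 - t) ^ (-(β + 1)) * (t * (n + β + 1) / (1 - t)) =
    t * (n + β + 1) * ((1 - t) ^ (-(β + 1)) / (1 - t)) := by ring
  rw [e2]
  refine h.congr_fun fun m => ?_
  have h2 := gbinom_succ_shift (n + β) m
  have e1 : (n : ℝ) + (m + 1 : ℕ) + β = n + β + (m + 1 : ℕ) := by ring
  rw [e1]
  push_cast at h2 ⊢
  rw [pow_succ]
  linear_combination h2 * t ^ m * t * (1 - t) ^ n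

lemma hasSum_kernel_col {β : ℝ} (hβ : -1 < β) (m : ℕ) {t : ℝ} (ht0 : 0 < t) (ht1 : t < 1) :
    HasSum (fun n : ℕ => poch n β * (gbinom (n + m + β) m * t ^ m * (1 - t) ^ n))
      (poch m β * t ^ (-(β + 1))) := by
  have h := (hasSum_kernel (β := β) m (t := 1 - t) (by linarith) (by linarith)).mul_left (poch m β)
  have e : 1 - (1 - t) = t := by ring
  rw [e] at h
  refine h.congr_fun fun n => ?_
  linear_combination poch_symm hβ n m * t ^ m * (1 - t) ^ n

lemma tangent {y κ : ℝ} (hy : 0 < y) (hκ : 0 ≤ κ) : 1 - κ * (y - 1) ≤ y ^ (-κ) := by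
  rw [Real.rpow_def_of_pos hy]
  have h1 := Real.add_one_le_exp (Real.log y * -κ)
  have h2 := Real.log_le_sub_one_of_pos hy
  nlinarith

lemma kernel_nonneg {β : ℝ} (hβ : -1 < β) (n m : ℕ) {t : ℝ} (ht0 : 0 ≤ t) (ht1 : t ≤ 1) :
    0 ≤ gbinom (n + m + β) m * t ^ m * (1 - t) ^ n := by
  have hn : (0:ℝ) ≤ n := n.cast_nonneg
  have := (gbinom_pos (x := n + β) (by linarith) m).le
  have e1 : (n : ℝ) + m + β = (n + β) + m := by ring
  rw [e1]
  have : 0 ≤ 1 - t := by linarith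
  positivity

/-- Jensen lower bound. -/
lemma jensen_lower {β κ : ℝ} (hβ : -1 < β) (hκ : 0 ≤ κ) (n : ℕ) {t : ℝ} (ht0 : 0 < t) (ht1 : t < 1) :
    Summable (fun m : ℕ => (gbinom (n + m + β) m * t ^ m * (1 - t) ^ n) * ((m : ℝ) + 1) ^ (-κ)) ∧
    (1 - t) ^ (-(β + 1)) * (t * (n + β + 1) / (1 - t) + 1) ^ (-κ) ≤
    ∑' m : ℕ, (gbinom (n + m + β) m * t ^ m * (1 - t) ^ n) * ((m : ℝ) + 1) ^ (-κ) := by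
  set k : ℕ → ℝ := fun m => gbinom (n + m + β) m * t ^ m * (1 - t) ^ n with hk
  have hn : (0:ℝ) ≤ n := n.cast_nonneg
  have h0 : 0 < 1 - t := by linarith
  set X : ℝ := t * (n + β + 1) / (1 - t) + 1 with hX
  have hX0 : 0 < X := by
    have : 0 < n + β + 1 := by linarith
    positivity
  have hk0 : ∀ m, 0 ≤ k m := fun m => kernel_nonneg hβ n m ht0.le ht1.le
  have s1 : HasSum k _ := hasSum_kernel (β := β) n ht0 ht1
  have s2 : HasSum (fun m : ℕ => (m : ℝ) * k m) _ := hasSum_kernel_mean (β := β) n ht0 ht1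
  have hs : Summable (fun m : ℕ => k m * ((m : ℝ) + 1) ^ (-κ)) := by
    refine Summable.of_nonneg_of_le (fun m => mul_nonneg (hk0 m) (by positivity)) (fun m => ?_)
      s1.summable
    refine mul_le_of_le_one_right (hk0 m) ?_
    apply Real.rpow_le_one_of_one_le_of_nonpos
    · have : (0:ℝ) ≤ m := m.cast_nonneg
      linarith
    · linarith
  refine ⟨hs, ?_⟩
  have s3 := ((s1.mul_left (1 + κ - κ / X)).sub (s2.mul_left (κ / X))).mul_left (X ^ (-κ))
  have := hasSum_le (fun m => ?_) s3 hs.hasSum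
  · refine le_trans (le_of_eq ?_) this
    have e : t * (n + β + 1) / (1 - t) = X - 1 := by rw [hX]; ring
    rw [e]
    field_simp
    ring
  · have hm : (0:ℝ) < (m : ℝ) + 1 := by positivity
    have ht := tangent (y := (m + 1) / X) (κ := κ) (by positivity) hκ
    rw [Real.div_rpow hm.le hX0.le, le_div_iff₀ (by positivity)] at ht
    have := mul_le_mul_of_nonneg_left ht (hk0 m)
    refine le_trans (le_of_eq ?_) this
    field_simp
    ring

/-- weighted Hölder -/
lemma holder_w {α : Type*} [MeasurableSpace α] (ν : Measure α) {p : ℝ} (hp : 1 ≤ p)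
    {g f : α → ℝ≥0∞} (hg : Measurable g) (hf : Measurable f) :
    (∫⁻ x, g x * f x ∂ν) ^ p ≤ (∫⁻ x, g x ∂ν) ^ (p - 1) * ∫⁻ x, g x * f x ^ p ∂ν := by
  rcases hp.eq_or_lt with rfl | hp
  · simp
  have hp0 : 0 < p := by linarith
  have hpq : p.HolderConjugate (p.conjExponent) := Real.HolderConjugate.conjExponent hp
  set q := p.conjExponent
  have h := ENNReal.lintegral_mul_le_Lp_mul_Lq ν hpq
    (f := fun x => g x ^ (1 / p) * f x) (g := fun x => g x ^ (1 / q))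
    ((hg.pow_const _).mul hf).aemeasurable (hg.pow_const _).aemeasurable
  have hq0 : 0 < q := hpq.symm.pos
  have e1 : ∀ x, ((fun x => g x ^ (1 / p) * f x) * (fun x => g x ^ (1 / q))) x = g x * f x := by
    intro x
    simp only [Pi.mul_apply]
    have : g x ^ (1 / p) * g x ^ (1 / q) = g x := by
      rw [← ENNReal.rpow_add_of_nonneg _ _ (by positivity) (by positivity)]
      have : 1 / p + 1 / q = 1 := by simpa using hpq.inv_add_inv_eq_one
      rw [this, ENNReal.rpow_one]
    rw [mul_right_comm, this]
  have e2 : ∀ x, (g x ^ (1 / p) * f x) ^ p = g x * f x ^ p := by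
    intro x
    rw [ENNReal.mul_rpow_of_nonneg _ _ hp0.le, ← ENNReal.rpow_mul, one_div_mul_cancel hp0.ne',
      ENNReal.rpow_one]
  have e3 : ∀ x, (g x ^ (1 / q)) ^ q = g x := by
    intro x
    rw [← ENNReal.rpow_mul, one_div_mul_cancel hq0.ne', ENNReal.rpow_one]
  simp only [e1, e2, e3] at h
  have h2 := ENNReal.rpow_le_rpow h hp0.le
  rw [ENNReal.mul_rpow_of_nonneg _ _ hp0.le, ← ENNReal.rpow_mul, ← ENNReal.rpow_mul,
    one_div_mul_cancel hp0.ne', ENNReal.rpow_one, mul_comm] at h2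
  have e4 : 1 / q * p = p - 1 := by
    have : 1 / p + 1 / q = 1 := by simpa using hpq.inv_add_inv_eq_one
    have h3 : 1 / q = 1 - 1 / p := by linarith
    rw [h3]; field_simp
  rwa [e4] at h2

lemma holder_tsum {p : ℝ} (hp : 1 ≤ p) (g f : ℕ → ℝ≥0∞) :
    (∑' x, g x * f x) ^ p ≤ (∑' x, g x) ^ (p - 1) * ∑' x, g x * f x ^ p := by
  simpa [lintegral_count] using holder_w (Measure.count : Measure ℕ) hp
    (measurable_of_countable g) (measurable_of_countable f)

/-- ENNReal kernel -/
noncomputable def kE (β : ℝ) (n m : ℕ) (t : ℝ) : ℝ≥0∞ :=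
  ENNReal.ofReal (gbinom (n + m + β) m * t ^ m * (1 - t) ^ n)

noncomputable def wE (β : ℝ) (n : ℕ) : ℝ≥0∞ := ENNReal.ofReal (poch n β)

noncomputable def cE (β p : ℝ) (t : ℝ) : ℝ≥0∞ :=
  ENNReal.ofReal ((1 - t) ^ (-(1 - 1 / p) * (β + 1)) * t ^ (-((β + 1) / p)))

lemma kE_meas (β : ℝ) (n m : ℕ) : Measurable (kE β n m) := by
  unfold kE; fun_prop

lemma cE_meas (β p : ℝ) : Measurable (cE β p) := by
  unfold cE; fun_prop

lemma cE_ne_zero (β p : ℝ) {t : ℝ} (ht : t ∈ Ioo (0:ℝ) 1) : cE β p t ≠ 0 := by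
  have h1 := ht.1
  have h2 : 0 < 1 - t := by linarith [ht.2]
  unfold cE
  rw [ne_eq, ENNReal.ofReal_eq_zero, not_le]
  positivity

lemma kE_row {β : ℝ} (hβ : -1 < β) (n : ℕ) {t : ℝ} (ht : t ∈ Ioo (0:ℝ) 1) :
    ∑' m, kE β n m t = ENNReal.ofReal ((1 - t) ^ (-(β + 1))) := by
  have h := hasSum_kernel (β := β) n ht.1 ht.2
  unfold kE
  rw [← ENNReal.ofReal_tsum_of_nonneg (fun m => kernel_nonneg hβ n m ht.1.le ht.2.le) h.summable,
    h.tsum_eq]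

lemma kE_col {β : ℝ} (hβ : -1 < β) (m : ℕ) {t : ℝ} (ht : t ∈ Ioo (0:ℝ) 1) :
    ∑' n, wE β n * kE β n m t = wE β m * ENNReal.ofReal (t ^ (-(β + 1))) := by
  have h := hasSum_kernel_col hβ m ht.1 ht.2
  unfold kE wE
  simp only [← ENNReal.ofReal_mul (poch_pos'_s5 hβ _).le]
  rw [← ENNReal.ofReal_tsum_of_nonneg (fun n => mul_nonneg (poch_pos'_s5 hβ _).le
    (kernel_nonneg hβ n m ht.1.le ht.2.le)) h.summable,
    h.tsum_eq]

lemma cE_rpow {β p : ℝ} (hp : 1 ≤ p) {t : ℝ} (ht : t ∈ Ioo (0:ℝ) 1) :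
    ENNReal.ofReal ((1 - t) ^ (-(β + 1))) ^ (p - 1) * ENNReal.ofReal (t ^ (-(β + 1))) =
      cE β p t ^ p := by
  have h1 := ht.1
  have h2 : 0 < 1 - t := by linarith [ht.2]
  have hp0 : 0 < p := by linarith
  unfold cE
  rw [ENNReal.ofReal_rpow_of_nonneg (by positivity) (by linarith),
    ENNReal.ofReal_rpow_of_nonneg (by positivity) (by linarith), ← ENNReal.ofReal_mul (by positivity),
    Real.mul_rpow (by positivity) (by positivity), ← Real.rpow_mul h2.le, ← Real.rpow_mul h2.le,
    ← Real.rpow_mul h1.le]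
  congr 3
  · field_simp
  · field_simp

/-- pointwise bound for a single t -/
lemma single_bound {β p : ℝ} (hβ : -1 < β) (hp : 1 ≤ p) {t : ℝ} (ht : t ∈ Ioo (0:ℝ) 1)
    (A : ℕ → ℝ≥0∞) :
    ∑' n, wE β n * (∑' m, kE β n m t * A m) ^ p ≤ cE β p t ^ p * ∑' m, wE β m * A m ^ p := by
  rw [← cE_rpow hp ht]
  calc _ ≤ ∑' n, wE β n * (ENNReal.ofReal ((1 - t) ^ (-(β + 1))) ^ (p - 1) *
        ∑' m, kE β n m t * A m ^ p) := by
        refine ENNReal.tsum_le_tsum fun n => ?_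
        gcongr
        rw [← kE_row hβ n ht]
        exact holder_tsum hp _ _
    _ = ENNReal.ofReal ((1 - t) ^ (-(β + 1))) ^ (p - 1) *
        ∑' n, ∑' m, wE β n * kE β n m t * A m ^ p := by
        rw [← ENNReal.tsum_mul_left]
        congr 1; ext n
        rw [mul_left_comm, ← ENNReal.tsum_mul_left]
        simp only [mul_assoc]
    _ = _ := by
        rw [ENNReal.tsum_comm]
        simp only [ENNReal.tsum_mul_right, kE_col hβ _ ht]
        rw [mul_assoc]
        congr 1
        rw [← ENNReal.tsum_mul_left]
        congr 1; ext m
        ring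

lemma upper_E {β p : ℝ} (hβ : -1 < β) (hp : 1 ≤ p) (μ : Measure ℝ) (A : ℕ → ℝ≥0∞) :
    ∑' n, wE β n * (∑' m, ∫⁻ t in Ioo (0:ℝ) 1, kE β n m t * A m ∂μ) ^ p ≤
      (∫⁻ t in Ioo (0:ℝ) 1, cE β p t ∂μ) ^ p * ∑' m, wE β m * A m ^ p := by
  set ν := μ.restrict (Ioo (0:ℝ) 1) with hν
  have hae : ∀ᵐ t ∂ν, t ∈ Ioo (0:ℝ) 1 := ae_restrict_mem measurableSet_Ioo
  have hc := cE_meas β p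
  have hk := kE_meas β
  have hF : ∀ n, Measurable (fun t => ∑' m, kE β n m t * A m) := fun n =>
    Measurable.tsum fun m => (hk n m).mul_const _
  have hp0 : 0 < p := by linarith
  set C := ∫⁻ t, cE β p t ∂ν with hC
  calc _ ≤ ∑' n, wE β n * (C ^ (p - 1) *
        ∫⁻ t, cE β p t * ((cE β p t)⁻¹ * ∑' m, kE β n m t * A m) ^ p ∂ν) := by
        refine ENNReal.tsum_le_tsum fun n => ?_
        gcongr
        rw [← lintegral_tsum fun m => ((hk n m).mul_const _).aemeasurable]
        refine le_trans (le_of_eq ?_) (holder_w ν hp hc (hc.inv.mul (hF n)))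
        congr 1
        refine lintegral_congr_ae ?_
        filter_upwards [hae] with t ht
        rw [← mul_assoc, ENNReal.mul_inv_cancel (cE_ne_zero β p ht) (by simp [cE]), one_mul]
    _ = C ^ (p - 1) * ∫⁻ t, ∑' n, wE β n * (cE β p t *
          ((cE β p t)⁻¹ * ∑' m, kE β n m t * A m) ^ p) ∂ν := by
        rw [lintegral_tsum, ← ENNReal.tsum_mul_left]
        · congr 1; ext n
          rw [lintegral_const_mul, mul_left_comm]
          exact hc.mul ((hc.inv.mul (hF n)).pow_const _)
        · intro n
          exact ((hc.mul ((hc.inv.mul (hF n)).pow_const _)).const_mul _).aemeasurable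
    _ ≤ C ^ (p - 1) * ∫⁻ t, cE β p t * ∑' m, wE β m * A m ^ p ∂ν := by
        refine mul_le_mul_right ?_ _
        refine lintegral_mono_ae ?_
        filter_upwards [hae] with t ht
        have hc0 := cE_ne_zero β p ht
        have hct : cE β p t ≠ ⊤ := by simp [cE]
        calc _ = cE β p t * ((cE β p t)⁻¹ ^ p * ∑' n, wE β n * (∑' m, kE β n m t * A m) ^ p) := by
              rw [← ENNReal.tsum_mul_left, ← ENNReal.tsum_mul_left]
              congr 1; ext n
              rw [ENNReal.mul_rpow_of_nonneg _ _ hp0.le]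
              ring
          _ ≤ cE β p t * ((cE β p t)⁻¹ ^ p * (cE β p t ^ p * ∑' m, wE β m * A m ^ p)) := by
              gcongr
              exact single_bound hβ hp ht A
          _ = _ := by
              rw [← mul_assoc (_ ^ p), ← ENNReal.mul_rpow_of_nonneg _ _ hp0.le,
                ENNReal.inv_mul_cancel hc0 hct, ENNReal.one_rpow, one_mul]
    _ = _ := by
        rw [lintegral_mul_const _ hc, ← mul_assoc]
        congr 1
        rw [← hC]
        nth_rw 2 [← ENNReal.rpow_one C]
        rw [← ENNReal.rpow_add_of_nonneg _ _ (by linarith) zero_le_one]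
        congr 1; ring

lemma ofReal_term {β p : ℝ} (hβ : -1 < β) (hp : 1 ≤ p) (n : ℕ) (z : ℂ) :
    ENNReal.ofReal (poch n β * ‖z‖ ^ p) = wE β n * ‖z‖ₑ ^ p := by
  rw [ENNReal.ofReal_mul (poch_pos'_s5 hβ n).le, wE,
    ← ENNReal.ofReal_rpow_of_nonneg (norm_nonneg _) (by linarith), ofReal_norm]

lemma enorm_smul_kernel {β : ℝ} (hβ : -1 < β) (n m : ℕ) {t : ℝ} (ht : t ∈ Ioo (0:ℝ) 1) (z : ℂ) :
    ‖(gbinom ((n : ℝ) + (m : ℝ) + β) m * t ^ m * (1 - t) ^ n) • z‖ₑ = kE β n m t * ‖z‖ₑ := by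
  rw [enorm_smul, Real.enorm_of_nonneg (kernel_nonneg hβ n m ht.1.le ht.2.le)]
  rfl

lemma Hb_le {β : ℝ} (hβ : -1 < β) (μ : Measure ℝ) (a : ℕ → ℂ) (n : ℕ) :
    ‖Hb μ β a n‖ₑ ≤ ∑' m, ∫⁻ t in Ioo (0:ℝ) 1, kE β n m t * ‖a m‖ₑ ∂μ := by
  unfold Hb
  refine (enorm_tsum_le_tsum_enorm).trans (ENNReal.tsum_le_tsum fun m => ?_)
  refine (enorm_integral_le_lintegral_enorm _).trans (le_of_eq ?_)
  refine setLIntegral_congr_fun measurableSet_Ioo fun t ht => ?_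
  exact enorm_smul_kernel hβ n m ht _

lemma upper_s5 {β p : ℝ} (hβ : -1 < β) (hp : 1 ≤ p) (μ : Measure ℝ) (a : ℕ → ℂ) :
    ∑' n : ℕ, ENNReal.ofReal (poch (n : ℝ) β * ‖Hb μ β a n‖ ^ p) ≤
      (∫⁻ t in Ioo (0:ℝ) 1, cE β p t ∂μ) ^ p *
        ∑' m : ℕ, ENNReal.ofReal (poch (m : ℝ) β * ‖a m‖ ^ p) := by
  simp only [ofReal_term hβ hp]
  refine le_trans (ENNReal.tsum_le_tsum fun n => ?_) (upper_E hβ hp μ _)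
  gcongr
  exact Hb_le hβ μ a n

lemma Gamma_prod {s : ℝ} (hs : 0 < s) (n : ℕ) :
    Real.Gamma (s + n) = (∏ j ∈ Finset.range n, (s + j)) * Real.Gamma s := by
  induction n with
  | zero => simp
  | succ k ih =>
    rw [Finset.prod_range_succ, Nat.cast_succ, ← add_assoc, Real.Gamma_add_one (by positivity), ih]
    ring

lemma poch_eq {β : ℝ} (hβ : -1 < β) {n : ℕ} (hn : 1 ≤ n) :
    poch ((n + 1 : ℕ) : ℝ) β * Real.GammaSeq (β + 1) n =
      Real.Gamma (β + 1) * ((n : ℝ) ^ (β + 1) / (n + 1)) := by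
  have h0 : 0 < β + 1 := by linarith
  have h1 := Gamma_prod h0 (n + 1)
  unfold poch Real.GammaSeq
  have e : ((n + 1 : ℕ) : ℝ) + β + 1 = β + 1 + (n + 1 : ℕ) := by push_cast; ring
  rw [e, h1, Real.Gamma_nat_eq_factorial, Nat.factorial_succ]
  have h2 : 0 < ∏ j ∈ Finset.range (n + 1), (β + 1 + (j : ℝ)) :=
    Finset.prod_pos fun j _ => by positivity
  push_cast
  field_simp

lemma poch_bounds {β : ℝ} (hβ : -1 < β) : ∀ᶠ n : ℕ in atTop,
    1 / 2 * ((n : ℝ) ^ (β + 1) / (n + 1)) ≤ poch ((n + 1 : ℕ) : ℝ) β ∧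
    poch ((n + 1 : ℕ) : ℝ) β ≤ 2 * ((n : ℝ) ^ (β + 1) / (n + 1)) := by
  have h0 : 0 < β + 1 := by linarith
  have hG := Real.Gamma_pos_of_pos h0
  have hT := Real.GammaSeq_tendsto_Gamma (β + 1)
  filter_upwards [eventually_ge_atTop 1,
    hT.eventually (lt_mem_nhds (show Real.Gamma (β + 1) / 2 < _ by linarith)),
    hT.eventually (gt_mem_nhds (show _ < Real.Gamma (β + 1) * 2 by linarith))] with n hn h1 h2
  have h := poch_eq hβ hn
  have hw := poch_pos'_s5 hβ (n + 1)
  set w := poch ((n + 1 : ℕ) : ℝ) β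
  set y := (n : ℝ) ^ (β + 1) / (n + 1)
  constructor
  · have : Real.Gamma (β + 1) * y ≤ w * (Real.Gamma (β + 1) * 2) := by rw [← h]; gcongr
    have : Real.Gamma (β + 1) * y ≤ Real.Gamma (β + 1) * (w * 2) := by linarith
    have := le_of_mul_le_mul_left this hG
    linarith
  · have : w * (Real.Gamma (β + 1) / 2) ≤ Real.Gamma (β + 1) * y := by rw [← h]; gcongr
    have : Real.Gamma (β + 1) * (w / 2) ≤ Real.Gamma (β + 1) * y := by linarith
    have := le_of_mul_le_mul_left this hG
    linarith

lemma poch_summable {β s : ℝ} (hβ : -1 < β) (hs : β + 1 < s) :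
    Summable fun n : ℕ => poch n β * ((n : ℝ) + 1) ^ (-s) := by
  rw [← summable_nat_add_iff 1]
  have hg : Summable fun n : ℕ => 2 * (n : ℝ) ^ (β - s) :=
    (Real.summable_nat_rpow.2 (by linarith)).mul_left 2
  refine Summable.of_norm_bounded_eventually_nat hg ?_
  filter_upwards [poch_bounds hβ, eventually_ge_atTop 1] with n hn h1
  have hn0 : (0:ℝ) < n := by exact_mod_cast h1
  have hw := poch_pos'_s5 hβ (n + 1)
  rw [Real.norm_of_nonneg (by positivity)]
  have e : 2 * (n : ℝ) ^ (β - s) = 2 * ((n : ℝ) ^ (β + 1) / n) * n ^ (-s) := by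
    rw [← Real.rpow_sub_one hn0.ne', mul_assoc, ← Real.rpow_add hn0]; congr 2; ring
  rw [e]
  have h2 : (((n + 1 : ℕ) : ℝ) + 1) ^ (-s) ≤ (n : ℝ) ^ (-s) := by
    apply Real.rpow_le_rpow_of_nonpos hn0
    · push_cast; linarith
    · linarith
  have h3 : (n : ℝ) ^ (β + 1) / (n + 1) ≤ (n : ℝ) ^ (β + 1) / n := by gcongr; linarith
  refine mul_le_mul (hn.2.trans ?_) h2 (by positivity) (by positivity)
  linarith

lemma poch_not_summable {β : ℝ} (hβ : -1 < β) :
    ¬ Summable fun n : ℕ => poch n β * ((n : ℝ) + 1) ^ (-(β + 1)) := by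
  rw [← summable_nat_add_iff 1]
  intro h
  have h0 : 0 < β + 1 := by linarith
  have : Summable fun n : ℕ => 1 / ((n + 1 : ℕ) : ℝ) := by
    refine Summable.of_norm_bounded_eventually_nat (h.mul_left (2 * 3 ^ (β + 1))) ?_
    filter_upwards [poch_bounds hβ, eventually_ge_atTop 1] with n hn h1
    have hn1 : (1:ℝ) ≤ n := by exact_mod_cast h1
    have hn0 : (0:ℝ) < n := by linarith
    rw [Real.norm_of_nonneg (by positivity)]
    have h2 : (3 * (n : ℝ)) ^ (-(β + 1)) ≤ (((n + 1 : ℕ) : ℝ) + 1) ^ (-(β + 1)) := by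
      apply Real.rpow_le_rpow_of_nonpos (by positivity)
      · push_cast; linarith
      · linarith
    calc _ = 2 * 3 ^ (β + 1) * ((1 / 2 * ((n : ℝ) ^ (β + 1) / (n + 1))) *
          (3 * (n : ℝ)) ^ (-(β + 1))) := by
          rw [Real.mul_rpow (by norm_num) hn0.le, Real.rpow_neg (by norm_num), Real.rpow_neg hn0.le]
          push_cast
          field_simp
      _ ≤ _ := by
          have hw := poch_pos'_s5 hβ (n + 1)
          gcongr
          exact hn.1
  rw [summable_nat_add_iff (f := fun n : ℕ => 1 / (n : ℝ)) 1] at this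
  exact Real.not_summable_one_div_natCast this

lemma limit_arg (w : ℕ → ℝ) (hw : ∀ n, 0 ≤ w n) (s p η A B : ℝ) (hp : 0 < p)
    (hη : 0 < η) (hη1 : η < 1) (hA : 0 ≤ A) (N : ℕ)
    (hns : ¬ Summable fun n : ℕ => w n * ((n : ℝ) + 1) ^ (-s))
    (hs : ∀ ε : ℝ, 0 < ε → Summable fun n : ℕ => w n * ((n : ℝ) + 1) ^ (-(s + ε * p)))
    (h : ∀ ε : ℝ, 0 < ε → ε ≤ 1 →
      η ^ (ε * p) * A * ∑' n : ℕ, w (n + N) * (((n + N : ℕ) : ℝ) + 1) ^ (-(s + ε * p)) ≤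
        B * ∑' n : ℕ, w n * ((n : ℝ) + 1) ^ (-(s + ε * p))) : A ≤ B := by
  by_contra! hAB
  set H : ℝ := ∑ n ∈ Finset.range N, w n * ((n : ℝ) + 1) ^ (-s) with hH
  have hnn : ∀ n : ℕ, ∀ r : ℝ, 0 ≤ w n * ((n : ℝ) + 1) ^ r := fun n r =>
    mul_nonneg (hw n) (by positivity)
  have hH0 : 0 ≤ H := Finset.sum_nonneg fun n _ => hnn n _
  rw [not_summable_iff_tendsto_nat_atTop_of_nonneg (fun n => hnn n _)] at hns
  obtain ⟨K, hK⟩ := (hns.eventually_gt_atTop (A * H / (A - B))).exists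
  rw [div_lt_iff₀ (by linarith)] at hK
  have hcont1 : Continuous fun ε : ℝ => η ^ (ε * p) * A - B :=
    ((Real.continuous_const_rpow hη.ne').comp (by fun_prop : Continuous fun ε : ℝ => ε * p)).mul_const A
      |>.sub continuous_const
  have hcont2 : Continuous fun ε : ℝ =>
      ∑ n ∈ Finset.range K, w n * ((n : ℝ) + 1) ^ (-(s + ε * p)) := by
    refine continuous_finsetSum _ fun n _ => ?_
    refine continuous_const.mul ((Real.continuous_const_rpow (by positivity)).comp
      (by fun_prop : Continuous fun ε : ℝ => -(s + ε * p)))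
  have ev1 : ∀ᶠ ε in 𝓝 (0:ℝ), 0 < η ^ (ε * p) * A - B :=
    hcont1.continuousAt.eventually (lt_mem_nhds (by simpa using hAB))
  have ev2 : ∀ᶠ ε in 𝓝 (0:ℝ), A * H < (∑ n ∈ Finset.range K, w n * ((n : ℝ) + 1) ^ (-(s + ε * p)))
      * (η ^ (ε * p) * A - B) :=
    (hcont2.mul hcont1).continuousAt.eventually (lt_mem_nhds (by simpa using hK))
  have ev3 : ∀ᶠ ε in 𝓝 (0:ℝ), ε < 1 := gt_mem_nhds one_pos
  have ev : ∀ᶠ ε in 𝓝[>] (0:ℝ), _ := (ev1.and (ev2.and ev3)).filter_mono nhdsWithin_le_nhds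
  obtain ⟨ε, ⟨e1, e2, e3⟩, e0⟩ := (ev.and self_mem_nhdsWithin).exists
  have e0 : 0 < ε := e0
  have hh := h ε e0 e3.le
  have hsum := hs ε e0
  have hsplit := hsum.sum_add_tsum_nat_add N
  have hpart := hsum.sum_le_tsum (Finset.range K) (fun n _ => hnn n _)
  set S := ∑' n : ℕ, w n * ((n : ℝ) + 1) ^ (-(s + ε * p))
  have hHε : ∑ n ∈ Finset.range N, w n * ((n : ℝ) + 1) ^ (-(s + ε * p)) ≤ H := by
    refine Finset.sum_le_sum fun n _ => mul_le_mul_of_nonneg_left ?_ (hw n)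
    apply Real.rpow_le_rpow_of_exponent_le
    · have : (0:ℝ) ≤ n := n.cast_nonneg
      linarith
    · nlinarith
  have hηε : η ^ (ε * p) ≤ 1 := Real.rpow_le_one hη.le hη1.le (by positivity)
  have hηε0 : 0 ≤ η ^ (ε * p) := by positivity
  set Hε := ∑ n ∈ Finset.range N, w n * ((n : ℝ) + 1) ^ (-(s + ε * p))
  have hHε0 : 0 ≤ Hε := Finset.sum_nonneg fun n _ => hnn n _
  have e4 := mul_le_mul_of_nonneg_right hpart e1.le
  have e5 : η ^ (ε * p) * A * Hε ≤ 1 * A * H := by gcongr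
  have e6 : ∑' n : ℕ, w (n + N) * (((n + N : ℕ) : ℝ) + 1) ^ (-(s + ε * p)) = S - Hε := by
    rw [← hsplit]; ring
  rw [e6] at hh
  nlinarith

lemma kernel_integrable (μ : Measure ℝ) [IsFiniteMeasure μ] (β c : ℝ) (n m : ℕ) :
    IntegrableOn (fun t : ℝ => gbinom (n + m + β) m * t ^ m * (1 - t) ^ n * c) (Ioo 0 1) μ := by
  refine IntegrableOn.mono_set (t := Icc 0 1) ?_ Ioo_subset_Icc_self
  exact Continuous.integrableOn_Icc (by fun_prop)

lemma Hb_trunc (μ : Measure ℝ) [IsFiniteMeasure μ] {β : ℝ} (hβ : -1 < β) (a : ℕ → ℝ)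
    (ha : ∀ m, 0 ≤ a m) (L n : ℕ) :
    ‖Hb μ β (fun m => if m < L then (a m : ℂ) else 0) n‖ₑ =
      ∑ m ∈ Finset.range L, ∫⁻ t in Ioo (0:ℝ) 1, kE β n m t * ENNReal.ofReal (a m) ∂μ := by
  have h1 : Hb μ β (fun m => if m < L then (a m : ℂ) else 0) n =
      ((∑ m ∈ Finset.range L, ∫ t in Ioo (0:ℝ) 1,
        gbinom (n + m + β) m * t ^ m * (1 - t) ^ n * a m ∂μ : ℝ) : ℂ) := by
    unfold Hb
    rw [tsum_eq_sum (s := Finset.range L), Complex.ofReal_sum]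
    · refine Finset.sum_congr rfl fun m hm => ?_
      rw [← integral_complex_ofReal]
      simp only [Finset.mem_range.1 hm, if_true, Complex.real_smul]
      push_cast
      rfl
    · intro m hm
      simp only [Finset.mem_range] at hm
      simp [hm]
  have hpos : ∀ m : ℕ, ∀ t ∈ Ioo (0:ℝ) 1, 0 ≤ gbinom (n + m + β) m * t ^ m * (1 - t) ^ n * a m :=
    fun m t ht => mul_nonneg (kernel_nonneg hβ n m ht.1.le ht.2.le) (ha m)
  have h_int_nonneg : ∀ m : ℕ, 0 ≤ ∫ t in Ioo (0:ℝ) 1, gbinom (n + m + β) m * t ^ m * (1 - t) ^ n * a m ∂μ :=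
    fun m => setIntegral_nonneg measurableSet_Ioo (hpos m)
  rw [h1, ← ofReal_norm, Complex.norm_real,
    Real.norm_of_nonneg (Finset.sum_nonneg fun m _ => h_int_nonneg m),
    ENNReal.ofReal_sum_of_nonneg fun m _ => h_int_nonneg m]
  refine Finset.sum_congr rfl fun m _ => ?_
  rw [ofReal_integral_eq_lintegral_ofReal (kernel_integrable μ β (a m) n m)
    ((ae_restrict_iff' measurableSet_Ioo).2 (Eventually.of_forall (hpos m)))]
  refine setLIntegral_congr_fun measurableSet_Ioo fun t ht => ?_
  exact ENNReal.ofReal_mul (kernel_nonneg hβ n m ht.1.le ht.2.le)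

lemma lower_E (μ : Measure ℝ) [IsFiniteMeasure μ] {β p M : ℝ} (hβ : -1 < β) (hp : 1 ≤ p)
    (hM : ∀ a : ℕ → ℂ,
        Summable (fun m : ℕ => poch (m : ℝ) β * ‖a m‖ ^ p) →
        ∑' n : ℕ, ENNReal.ofReal (poch (n : ℝ) β * ‖Hb μ β a n‖ ^ p) ≤
          ENNReal.ofReal M ^ p *
            ∑' m : ℕ, ENNReal.ofReal (poch (m : ℝ) β * ‖a m‖ ^ p))
    (a : ℕ → ℝ) (ha : ∀ m, 0 ≤ a m) :
    ∑' n, wE β n * (∑' m, ∫⁻ t in Ioo (0:ℝ) 1, kE β n m t * ENNReal.ofReal (a m) ∂μ) ^ p ≤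
      ENNReal.ofReal M ^ p * ∑' m, wE β m * ENNReal.ofReal (a m) ^ p := by
  have hp0 : 0 < p := by linarith
  have key : ∀ L : ℕ, ∑' n, wE β n * (∑ m ∈ Finset.range L,
      ∫⁻ t in Ioo (0:ℝ) 1, kE β n m t * ENNReal.ofReal (a m) ∂μ) ^ p ≤
      ENNReal.ofReal M ^ p * ∑' m, wE β m * ENNReal.ofReal (a m) ^ p := by
    intro L
    have h := hM (fun m => if m < L then (a m : ℂ) else 0) ?_
    · simp only [ofReal_term hβ hp, Hb_trunc μ hβ a ha] at h
      refine h.trans ?_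
      gcongr with m
      split_ifs
      · rw [← ofReal_norm, Complex.norm_real, Real.norm_of_nonneg (ha m)]
      · simp
    · refine summable_of_ne_finset_zero (s := Finset.range L) fun m hm => ?_
      simp only [Finset.mem_range] at hm
      simp [hm, hp0.ne']
  rw [ENNReal.tsum_eq_iSup_sum]
  refine iSup_le fun s => ?_
  have ht : Tendsto (fun L : ℕ => ∑ n ∈ s, wE β n * (∑ m ∈ Finset.range L,
      ∫⁻ t in Ioo (0:ℝ) 1, kE β n m t * ENNReal.ofReal (a m) ∂μ) ^ p) atTop
      (𝓝 (∑ n ∈ s, wE β n * (∑' m, ∫⁻ t in Ioo (0:ℝ) 1,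
        kE β n m t * ENNReal.ofReal (a m) ∂μ) ^ p)) := by
    refine tendsto_finsetSum _ fun n _ => ?_
    refine ENNReal.Tendsto.const_mul ?_ (Or.inr (by simp [wE]))
    exact (ENNReal.continuous_rpow_const.tendsto _).comp ENNReal.summable.hasSum.tendsto_sum_nat
  exact le_of_tendsto' ht fun L => (ENNReal.sum_le_tsum s).trans (key L)

lemma point_lower {β p ε η : ℝ} (hβ : -1 < β) (hp : 1 ≤ p) (hε : 0 < ε) (hε1 : ε ≤ 1)
    (hη : 0 < η) {N n : ℕ} (hn : N ≤ n) {t : ℝ} (ht : t ∈ Icc η (1 - η)) :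
    η ^ ε * (1 + (β + 1 + 1 / η) / (N + 1)) ^ (-((β + 1) / p + 1)) *
      ((n : ℝ) + 1) ^ (-((β + 1) / p + ε)) *
      ((1 - t) ^ (-(1 - 1 / p) * (β + 1)) * t ^ (-((β + 1) / p))) ≤
    (1 - t) ^ (-(β + 1)) * (t * (n + β + 1) / (1 - t) + 1) ^ (-((β + 1) / p + ε)) := by
  have ht0 : 0 < t := by linarith [ht.1]
  have ht1 : 0 < 1 - t := by linarith [ht.2]
  have hp0 : 0 < p := by linarith
  have hb : 0 < β + 1 := by linarith
  set κ := (β + 1) / p with hκ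
  have hκ0 : 0 < κ := by positivity
  set D := β + 1 + 1 / η with hD
  have hD0 : 0 < D := by positivity
  have hX : t * (n + β + 1) / (1 - t) + 1 ≤ (t / (1 - t)) * ((n + 1) * (1 + D / (N + 1))) := by
    have e : t * (n + β + 1) / (1 - t) + 1 = (t / (1 - t)) * (n + β + 1 + (1 - t) / t) := by
      field_simp
    rw [e]
    have h1 : (1 - t) / t ≤ 1 / η := by
      gcongr
      · linarith
      · exact ht.1
    have h2 : D ≤ (n + 1) * (D / (N + 1)) := by
      rw [mul_div_assoc', le_div_iff₀ (by positivity), mul_comm]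
      have : (N : ℝ) ≤ n := by exact_mod_cast hn
      gcongr
    gcongr
    rw [mul_add]
    linarith
  have hX0 : 0 < t * (n + β + 1) / (1 - t) + 1 := by
    have : (0:ℝ) ≤ n := n.cast_nonneg
    have : 0 < n + β + 1 := by linarith
    positivity
  have h3 := Real.rpow_le_rpow_of_nonpos hX0 hX (show -(κ + ε) ≤ 0 by linarith)
  refine le_trans ?_ (mul_le_mul_of_nonneg_left h3 (by positivity))
  rw [Real.mul_rpow (by positivity) (by positivity), Real.mul_rpow (by positivity) (by positivity)]
  have h4 : (1 + D / (N + 1)) ^ (-(κ + 1)) ≤ (1 + D / (N + 1)) ^ (-(κ + ε)) := by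
    apply Real.rpow_le_rpow_of_exponent_le
    · have : 0 < D / (N + 1) := by positivity
      linarith
    · linarith
  have h5 : η ^ ε * ((1 - t) ^ κ * t ^ (-κ)) ≤ (t / (1 - t)) ^ (-(κ + ε)) := by
    have e : (t / (1 - t)) ^ (-(κ + ε)) = ((1 - t) / t) ^ ε * ((1 - t) ^ κ * t ^ (-κ)) := by
      rw [neg_add, Real.rpow_add (by positivity), Real.rpow_neg (by positivity) ε,
        ← Real.inv_rpow (by positivity), inv_div, Real.div_rpow ht0.le ht1.le,
        Real.rpow_neg ht1.le κ]
      field_simp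
    rw [e]
    gcongr
    rw [le_div_iff₀ ht0]
    have := ht.2
    have : η * t ≤ η * 1 := by gcongr; linarith
    linarith
  have e1 : (1 - t) ^ (-(1 - 1 / p) * (β + 1)) = (1 - t) ^ (-(β + 1)) * (1 - t) ^ κ := by
    rw [← Real.rpow_add ht1]; congr 1; rw [hκ]; ring
  rw [e1]
  calc _ = (1 - t) ^ (-(β + 1)) * ((η ^ ε * ((1 - t) ^ κ * t ^ (-κ))) *
        (((n : ℝ) + 1) ^ (-(κ + ε)) * (1 + D / (N + 1)) ^ (-(κ + 1)))) := by ring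
    _ ≤ _ := by gcongr

lemma point_lower_E {β p ε η : ℝ} (hβ : -1 < β) (hp : 1 ≤ p) (hε : 0 < ε) (hε1 : ε ≤ 1)
    (hη : 0 < η) {N n : ℕ} (hn : N ≤ n) {t : ℝ} (ht : t ∈ Icc η (1 - η)) :
    ENNReal.ofReal (η ^ ε * (1 + (β + 1 + 1 / η) / (N + 1)) ^ (-((β + 1) / p + 1)) *
      ((n : ℝ) + 1) ^ (-((β + 1) / p + ε))) * cE β p t ≤
    ∑' m, kE β n m t * ENNReal.ofReal (((m : ℝ) + 1) ^ (-((β + 1) / p + ε))) := by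
  have ht0 : 0 < t := by linarith [ht.1]
  have ht1 : t < 1 := by linarith [ht.2]
  have hp0 : 0 < p := by linarith
  have hb : 0 < β + 1 := by linarith
  have hj := jensen_lower hβ (show 0 ≤ (β + 1) / p + ε by positivity) n ht0 ht1
  unfold kE cE
  simp only [← ENNReal.ofReal_mul (kernel_nonneg hβ n _ ht0.le ht1.le)]
  rw [← ENNReal.ofReal_tsum_of_nonneg (fun m => mul_nonneg (kernel_nonneg hβ n m ht0.le ht1.le)
    (by positivity)) hj.1, ← ENNReal.ofReal_mul (by positivity)]
  exact ENNReal.ofReal_le_ofReal ((point_lower hβ hp hε hε1 hη hn ht).trans hj.2)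

lemma cE_finite (μ : Measure ℝ) [IsFiniteMeasure μ] {β p η : ℝ} (hβ : -1 < β) (hp : 1 ≤ p)
    (hη : 0 < η) : ∫⁻ t in Icc η (1 - η), cE β p t ∂μ ≠ ⊤ := by
  have hp0 : 0 < p := by linarith
  have hb : 0 < β + 1 := by linarith
  have h1 : 1 / p ≤ 1 := by rw [div_le_one hp0]; exact hp
  have : ∫⁻ t in Icc η (1 - η), cE β p t ∂μ ≤ ∫⁻ _t in Icc η (1 - η),
      ENNReal.ofReal (η ^ (-(1 - 1 / p) * (β + 1)) * η ^ (-((β + 1) / p))) ∂μ := by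
    refine setLIntegral_mono measurable_const fun t ht => ?_
    have ht0 : 0 < t := by linarith [ht.1]
    have ht1 : 0 < 1 - t := by linarith [ht.2]
    unfold cE
    refine ENNReal.ofReal_le_ofReal (mul_le_mul ?_ ?_ (by positivity) (by positivity))
    · refine Real.rpow_le_rpow_of_nonpos hη (by linarith [ht.2]) ?_
      nlinarith
    · refine Real.rpow_le_rpow_of_nonpos hη ht.1 ?_
      have : 0 < (β + 1) / p := by positivity
      linarith
  refine ne_top_of_le_ne_top ?_ this
  rw [setLIntegral_const]
  exact ENNReal.mul_ne_top ENNReal.ofReal_ne_top (measure_ne_top _ _)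

lemma lower_eta (μ : Measure ℝ) [IsFiniteMeasure μ] {β p M η : ℝ} (hβ : -1 < β) (hp : 1 ≤ p)
    (hM0 : 0 ≤ M)
    (hM : ∀ a : ℕ → ℂ,
        Summable (fun m : ℕ => poch (m : ℝ) β * ‖a m‖ ^ p) →
        ∑' n : ℕ, ENNReal.ofReal (poch (n : ℝ) β * ‖Hb μ β a n‖ ^ p) ≤
          ENNReal.ofReal M ^ p *
            ∑' m : ℕ, ENNReal.ofReal (poch (m : ℝ) β * ‖a m‖ ^ p))
    (hη : 0 < η) (hη1 : η < 1) : ∫⁻ t in Icc η (1 - η), cE β p t ∂μ ≤ ENNReal.ofReal M := by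
  have hp0 : 0 < p := by linarith
  have hb : 0 < β + 1 := by linarith
  have hfin := cE_finite μ hβ hp hη
  set C := ∫⁻ t in Icc η (1 - η), cE β p t ∂μ with hC
  rw [← ENNReal.ofReal_toReal hfin]
  apply ENNReal.ofReal_le_ofReal
  set c := C.toReal
  have hc0 : 0 ≤ c := ENNReal.toReal_nonneg
  have hCc : C = ENNReal.ofReal c := (ENNReal.ofReal_toReal hfin).symm
  set D := β + 1 + 1 / η with hD
  have hD0 : 0 < D := by positivity
  have main : ∀ N : ℕ, (1 + D / ((N : ℝ) + 1)) ^ (-((β + 1) / p + 1)) * c ≤ M := by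
    intro N
    set q := (1 + D / ((N : ℝ) + 1)) ^ (-((β + 1) / p + 1)) with hq
    have hq0 : 0 ≤ q := by positivity
    rw [← Real.rpow_le_rpow_iff (by positivity) hM0 hp0]
    have hexp : ∀ (ε : ℝ) (n : ℕ), (((n : ℝ) + 1) ^ (-((β + 1) / p + ε))) ^ p =
        ((n : ℝ) + 1) ^ (-(β + 1 + ε * p)) := by
      intro ε n
      rw [← Real.rpow_mul (by positivity)]
      congr 1
      field_simp
    refine limit_arg (fun n => poch n β) (fun n => (poch_pos'_s5 hβ n).le) (β + 1) p η _ _ hp0 hη hη1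
      (by positivity) N (poch_not_summable hβ)
      (fun ε hε => poch_summable hβ (by nlinarith)) ?_
    intro ε hε hε1
    have hS := poch_summable hβ (show β + 1 < β + 1 + ε * p by nlinarith)
    have hL := lower_E μ hβ hp hM (fun m => ((m : ℝ) + 1) ^ (-((β + 1) / p + ε)))
      (fun m => by positivity)
    have hterm : ∀ n : ℕ, 0 ≤ poch n β * ((n : ℝ) + 1) ^ (-(β + 1 + ε * p)) := fun n =>
      mul_nonneg (poch_pos'_s5 hβ n).le (by positivity)
    have hR : ENNReal.ofReal M ^ p * ∑' m : ℕ, wE β m *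
        ENNReal.ofReal (((m : ℝ) + 1) ^ (-((β + 1) / p + ε))) ^ p =
        ENNReal.ofReal (M ^ p * ∑' n : ℕ, poch n β * ((n : ℝ) + 1) ^ (-(β + 1 + ε * p))) := by
      rw [ENNReal.ofReal_mul (by positivity), ENNReal.ofReal_rpow_of_nonneg hM0 hp0.le,
        ENNReal.ofReal_tsum_of_nonneg hterm hS]
      congr 2
      ext n
      rw [ENNReal.ofReal_rpow_of_nonneg (by positivity) hp0.le, wE,
        ← ENNReal.ofReal_mul (poch_pos'_s5 hβ n).le, hexp]
    rw [hR] at hL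
    have hE : ∀ n : ℕ, N ≤ n → ENNReal.ofReal (η ^ ε * q * ((n : ℝ) + 1) ^ (-((β + 1) / p + ε)) * c) ≤
        ∑' m, ∫⁻ t in Ioo (0:ℝ) 1, kE β n m t *
          ENNReal.ofReal (((m : ℝ) + 1) ^ (-((β + 1) / p + ε))) ∂μ := by
      intro n hn
      rw [← lintegral_tsum fun m => ((kE_meas β n m).mul_const _).aemeasurable,
        ENNReal.ofReal_mul (by positivity), ← hCc, hC, ← lintegral_const_mul _ (cE_meas β p)]
      refine le_trans ?_ (lintegral_mono_set (s := Icc η (1 - η)) ?_)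
      · exact setLIntegral_mono' measurableSet_Icc fun t ht =>
          point_lower_E hβ hp hε hε1 hη hn ht
      · intro t ht
        exact ⟨by linarith [ht.1], by linarith [ht.2]⟩
    have hS' := (summable_nat_add_iff N).2 hS
    have hfinal : ENNReal.ofReal (η ^ (ε * p) * (q * c) ^ p *
        ∑' n : ℕ, poch ((n + N : ℕ) : ℝ) β * (((n + N : ℕ) : ℝ) + 1) ^ (-(β + 1 + ε * p))) ≤
        ENNReal.ofReal (M ^ p * ∑' n : ℕ, poch n β * ((n : ℝ) + 1) ^ (-(β + 1 + ε * p))) := by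
      refine le_trans ?_ hL
      rw [ENNReal.ofReal_mul (by positivity),
        ENNReal.ofReal_tsum_of_nonneg (fun n => hterm (n + N)) hS', ← ENNReal.tsum_mul_left]
      refine le_trans (ENNReal.tsum_le_tsum fun n => ?_)
        (ENNReal.tsum_comp_le_tsum_of_injective (add_left_injective N) _)
      have h1 := ENNReal.rpow_le_rpow (hE (n + N) (Nat.le_add_left N n)) hp0.le
      refine le_trans (le_of_eq ?_) (mul_le_mul_right h1 _)
      rw [ENNReal.ofReal_rpow_of_nonneg (by positivity) hp0.le, wE,
        ← ENNReal.ofReal_mul (poch_pos'_s5 hβ _).le, ← ENNReal.ofReal_mul (by positivity)]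
      congr 1
      have e : η ^ ε * q * (((n + N : ℕ) : ℝ) + 1) ^ (-((β + 1) / p + ε)) * c =
        η ^ ε * (q * c) * (((n + N : ℕ) : ℝ) + 1) ^ (-((β + 1) / p + ε)) := by ring
      have e' : (η ^ ε * (q * c)) ^ p = (η ^ ε) ^ p * (q * c) ^ p :=
        Real.mul_rpow (by positivity) (by positivity)
      have e2 : (η ^ ε * (q * c) * (((n + N : ℕ) : ℝ) + 1) ^ (-((β + 1) / p + ε))) ^ p =
          (η ^ ε * (q * c)) ^ p * ((((n + N : ℕ) : ℝ) + 1) ^ (-((β + 1) / p + ε))) ^ p :=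
        Real.mul_rpow (by positivity) (by positivity)
      rw [e, e2, e', hexp, ← Real.rpow_mul hη.le]
      ring
    rwa [ENNReal.ofReal_le_ofReal_iff (mul_nonneg (by positivity) (tsum_nonneg hterm))] at hfinal
  have hlim : Tendsto (fun N : ℕ => (1 + D / ((N : ℝ) + 1)) ^ (-((β + 1) / p + 1)) * c) atTop
      (𝓝 ((1 + 0) ^ (-((β + 1) / p + 1)) * c)) := by
    refine Tendsto.mul_const c ?_
    refine Tendsto.rpow_const ?_ (Or.inl (by norm_num))
    refine tendsto_const_nhds.add ?_
    have := (tendsto_const_nhds (x := D)).div_atTop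
      (tendsto_natCast_atTop_atTop (R := ℝ) |>.atTop_add (tendsto_const_nhds (x := (1:ℝ))))
    exact this
  have := le_of_tendsto' hlim main
  simpa using this

lemma lower_main (μ : Measure ℝ) [IsFiniteMeasure μ] {β p M : ℝ} (hβ : -1 < β) (hp : 1 ≤ p)
    (hM0 : 0 ≤ M)
    (hM : ∀ a : ℕ → ℂ,
        Summable (fun m : ℕ => poch (m : ℝ) β * ‖a m‖ ^ p) →
        ∑' n : ℕ, ENNReal.ofReal (poch (n : ℝ) β * ‖Hb μ β a n‖ ^ p) ≤
          ENNReal.ofReal M ^ p *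
            ∑' m : ℕ, ENNReal.ofReal (poch (m : ℝ) β * ‖a m‖ ^ p)) :
    ∫⁻ t in Ioo (0:ℝ) 1, cE β p t ∂μ ≤ ENNReal.ofReal M := by
  have hU : Ioo (0:ℝ) 1 ⊆ ⋃ k : ℕ, Icc (1 / ((k : ℝ) + 2)) (1 - 1 / ((k : ℝ) + 2)) := by
    intro t ht
    have hpos : 0 < min t (1 - t) := lt_min ht.1 (by linarith [ht.2])
    obtain ⟨k, hk⟩ := exists_nat_one_div_lt hpos
    have h1 : 1 / ((k : ℝ) + 2) ≤ 1 / ((k : ℝ) + 1) := by gcongr; norm_num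
    have h2 := min_le_left t (1 - t)
    have h3 := min_le_right t (1 - t)
    exact mem_iUnion.2 ⟨k, by linarith, by linarith⟩
  refine (lintegral_mono_set hU).trans ?_
  rw [setLIntegral_iUnion_of_directed]
  · refine iSup_le fun k => lower_eta μ hβ hp hM0 hM (by positivity) ?_
    rw [div_lt_one (by positivity)]
    have : (0:ℝ) ≤ k := k.cast_nonneg
    linarith
  · refine Monotone.directed_le (f := fun k : ℕ => Icc (1 / ((k : ℝ) + 2)) (1 - 1 / ((k : ℝ) + 2))) ?_
    intro i j hij
    have h : 1 / ((j : ℝ) + 2) ≤ 1 / ((i : ℝ) + 2) := by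
      have : (i : ℝ) ≤ j := by exact_mod_cast hij
      gcongr
    exact Icc_subset_Icc h (by linarith)

/-- For `1 ≤ p < ∞` and `β > -1`, `H_μ^β` is bounded on `ℓ^p_w` with weight
`w(m) = (m+1)_β` iff `C_μ(β,p) = ∫_{(0,1)} (1-t)^{-(1-1/p)(β+1)} t^{-(β+1)/p} dμ(t) < ∞`,
and in that case the operator norm (the least bound `M`) equals `C_μ(β,p)`. -/
theorem Hb_bounded_lp_iff (μ : Measure ℝ) [IsFiniteMeasure μ] (p β : ℝ)
    (hp : 1 ≤ p) (hβ : -1 < β) :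
    ((∃ M : ℝ, 0 ≤ M ∧ ∀ a : ℕ → ℂ,
        Summable (fun m : ℕ => poch (m : ℝ) β * ‖a m‖ ^ p) →
        ∑' n : ℕ, ENNReal.ofReal (poch (n : ℝ) β * ‖Hb μ β a n‖ ^ p) ≤
          ENNReal.ofReal M ^ p *
            ∑' m : ℕ, ENNReal.ofReal (poch (m : ℝ) β * ‖a m‖ ^ p)) ↔
      (∫⁻ t in Ioo (0 : ℝ) 1,
        ENNReal.ofReal ((1 - t) ^ (-(1 - 1 / p) * (β + 1)) * t ^ (-((β + 1) / p))) ∂μ) ≠ ⊤) ∧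
    ((∃ M : ℝ, 0 ≤ M ∧ ∀ a : ℕ → ℂ,
        Summable (fun m : ℕ => poch (m : ℝ) β * ‖a m‖ ^ p) →
        ∑' n : ℕ, ENNReal.ofReal (poch (n : ℝ) β * ‖Hb μ β a n‖ ^ p) ≤
          ENNReal.ofReal M ^ p *
            ∑' m : ℕ, ENNReal.ofReal (poch (m : ℝ) β * ‖a m‖ ^ p)) →
      IsLeast {M : ℝ | 0 ≤ M ∧ ∀ a : ℕ → ℂ,
          Summable (fun m : ℕ => poch (m : ℝ) β * ‖a m‖ ^ p) →
          ∑' n : ℕ, ENNReal.ofReal (poch (n : ℝ) β * ‖Hb μ β a n‖ ^ p) ≤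
            ENNReal.ofReal M ^ p *
              ∑' m : ℕ, ENNReal.ofReal (poch (m : ℝ) β * ‖a m‖ ^ p)}
        (∫⁻ t in Ioo (0 : ℝ) 1,
          ENNReal.ofReal ((1 - t) ^ (-(1 - 1 / p) * (β + 1)) *
            t ^ (-((β + 1) / p))) ∂μ).toReal) := by
  change (_ ↔ ∫⁻ t in Ioo (0:ℝ) 1, cE β p t ∂μ ≠ ⊤) ∧ (_ → IsLeast _
    (∫⁻ t in Ioo (0:ℝ) 1, cE β p t ∂μ).toReal)
  have hup : ∫⁻ t in Ioo (0:ℝ) 1, cE β p t ∂μ ≠ ⊤ → ∀ a : ℕ → ℂ,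
      ∑' n : ℕ, ENNReal.ofReal (poch (n : ℝ) β * ‖Hb μ β a n‖ ^ p) ≤
        ENNReal.ofReal (∫⁻ t in Ioo (0:ℝ) 1, cE β p t ∂μ).toReal ^ p *
          ∑' m : ℕ, ENNReal.ofReal (poch (m : ℝ) β * ‖a m‖ ^ p) := by
    intro hC a
    rw [ENNReal.ofReal_toReal hC]
    exact upper_s5 hβ hp μ a
  constructor
  · constructor
    · rintro ⟨M, hM0, hM⟩
      exact ne_top_of_le_ne_top ENNReal.ofReal_ne_top (lower_main μ hβ hp hM0 hM)
    · intro hC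
      exact ⟨_, ENNReal.toReal_nonneg, fun a _ => hup hC a⟩
  · rintro ⟨M, hM0, hM⟩
    have hC := ne_top_of_le_ne_top ENNReal.ofReal_ne_top (lower_main μ hβ hp hM0 hM)
    refine ⟨⟨ENNReal.toReal_nonneg, fun a _ => hup hC a⟩, ?_⟩
    rintro M' ⟨hM0', hM'⟩
    exact ENNReal.toReal_le_of_le_ofReal hM0' (lower_main μ hβ hp hM0' hM')
end

section
/- Let μ be a positive finite Borel measure on (0,1) and let β > -1. Then H_μ^β is bounded on l^∞ if and only if C_μ(β,∞) = ∫_{(0,1)} (1-t)^{-β-1} dμ(t) < ∞. Moreover, when H_μ^β is bounded on l^∞, its operator norm equals C_μ(β,∞). -/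
open MeasureTheory Set

lemma gbinom_eq_choose (γ : ℝ) (m : ℕ) : gbinom γ m = Ring.choose γ m := by
  have h : (descPochhammer ℤ m).smeval γ = ∏ i ∈ Finset.range m, (γ - (i : ℝ)) := by
    rw [← descPochhammer_eval_eq_prod_range, ← descPochhammer_map (Int.castRingHom ℝ),
      Polynomial.eval_map, ← Polynomial.eval₂_smulOneHom_eq_smeval]
    congr 1
    exact Subsingleton.elim _ _
  rw [Ring.choose_eq_smul, h, gbinom, div_eq_inv_mul, smul_eq_mul]

lemma gbinom_nonneg_aux {β : ℝ} (hβ : -1 < β) (n m : ℕ) :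
    0 ≤ gbinom ((n : ℝ) + (m : ℝ) + β) m := by
  unfold gbinom
  refine div_nonneg (Finset.prod_nonneg fun i hi => ?_) (Nat.cast_nonneg _)
  have h : (i : ℝ) + 1 ≤ m := by exact_mod_cast Finset.mem_range.1 hi
  have : (0 : ℝ) ≤ n := Nat.cast_nonneg n
  linarith

/-- The kernel. -/
noncomputable def gker (β : ℝ) (n m : ℕ) (t : ℝ) : ℝ :=
  gbinom ((n : ℝ) + (m : ℝ) + β) m * t ^ m * (1 - t) ^ n

lemma gker_nonneg {β : ℝ} (hβ : -1 < β) (n m : ℕ) {t : ℝ} (ht : t ∈ Ioo (0 : ℝ) 1) :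
    0 ≤ gker β n m t :=
  mul_nonneg (mul_nonneg (gbinom_nonneg_aux hβ n m) (pow_nonneg ht.1.le _))
    (pow_nonneg (by linarith [ht.2]) _)

lemma gker_continuous (β : ℝ) (n m : ℕ) : Continuous (gker β n m) := by
  unfold gker
  fun_prop

lemma gker_hasSum (β : ℝ) (n : ℕ) {t : ℝ} (ht : t ∈ Ioo (0 : ℝ) 1) :
    HasSum (fun m => gker β n m t) ((1 - t) ^ (-β - 1)) := by
  have h1 : 0 < 1 - t := by linarith [ht.2]
  have hb : t ∈ Metric.eball (0 : ℝ) 1 := by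
    rw [Metric.mem_eball, edist_zero_right, Real.enorm_eq_ofReal ht.1.le]
    simpa using ht.2
  have h := (Real.one_div_one_sub_rpow_hasFPowerSeriesOnBall_zero ((n : ℝ) + β + 1)).hasSum hb
  have h2 := h.mul_right ((1 - t) ^ n)
  have e1 : (fun m => gker β n m t) = fun m : ℕ => (FormalMultilinearSeries.ofScalars ℝ
      (fun k : ℕ => Ring.choose ((n : ℝ) + β + 1 + (k : ℝ) - 1) k) m (fun _ => t)) *
        (1 - t) ^ n := by
    funext m
    rw [FormalMultilinearSeries.ofScalars_apply_eq, gker, gbinom_eq_choose, smul_eq_mul]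
    congr 3
    ring
  have e2 : (1 - t) ^ (-β - 1) = 1 / (1 - (0 + t)) ^ ((n : ℝ) + β + 1) * (1 - t) ^ n := by
    rw [zero_add, one_div, ← Real.rpow_neg h1.le, ← Real.rpow_natCast, ← Real.rpow_add h1]
    congr 1
    ring
  rw [e1, e2]
  exact h2

lemma gker_tsum_lintegral (μ : Measure ℝ) {β : ℝ} (hβ : -1 < β) (n : ℕ) :
    ∑' m, ∫⁻ t in Ioo (0 : ℝ) 1, ENNReal.ofReal (gker β n m t) ∂μ =
      ∫⁻ t in Ioo (0 : ℝ) 1, ENNReal.ofReal ((1 - t) ^ (-β - 1)) ∂μ := by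
  rw [← lintegral_tsum]
  · refine setLIntegral_congr_fun measurableSet_Ioo fun t ht => ?_
    have h := gker_hasSum β n ht
    rw [← h.tsum_eq, ENNReal.ofReal_tsum_of_nonneg (fun m => gker_nonneg hβ n m ht) h.summable]
  · intro m
    exact ((gker_continuous β n m).measurable.ennreal_ofReal).aemeasurable

lemma gker_integrable (μ : Measure ℝ) [IsFiniteMeasure μ] (β : ℝ) (n m : ℕ) :
    Integrable (gker β n m) (μ.restrict (Ioo (0 : ℝ) 1)) :=
  (((gker_continuous β n m).continuousOn).integrableOn_compact isCompact_Icc).mono_set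
    (Ioo_subset_Icc_self (a := (0 : ℝ)) (b := 1))

lemma Hb_lower (μ : Measure ℝ) [IsFiniteMeasure μ] {β : ℝ} (hβ : -1 < β) {M : ℝ}
    (h : ∀ a : ℕ → ℂ, (⨆ n : ℕ, ENNReal.ofReal ‖a n‖) ≠ ⊤ →
        (⨆ n : ℕ, ENNReal.ofReal ‖Hb μ β a n‖) ≤
          ENNReal.ofReal M * ⨆ n : ℕ, ENNReal.ofReal ‖a n‖) :
    (∫⁻ t in Ioo (0 : ℝ) 1, ENNReal.ofReal ((1 - t) ^ (-β - 1)) ∂μ) ≤ ENNReal.ofReal M := by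
  rw [← gker_tsum_lintegral μ hβ 0]
  refine ENNReal.tsum_le_of_sum_range_le fun N => ?_
  have hnn : ∀ m, 0 ≤ ∫ t in Ioo (0 : ℝ) 1, gker β 0 m t ∂μ := fun m =>
    setIntegral_nonneg measurableSet_Ioo fun t ht => gker_nonneg hβ 0 m ht
  let a : ℕ → ℂ := fun m => if m < N then 1 else 0
  have ha : (⨆ n : ℕ, ENNReal.ofReal ‖a n‖) ≤ 1 := by
    refine iSup_le fun n => ?_
    by_cases hn : n < N <;> simp [a, hn]
  have hH : Hb μ β a 0 = ((∑ m ∈ Finset.range N, ∫ t in Ioo (0 : ℝ) 1, gker β 0 m t ∂μ : ℝ) : ℂ) := by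
    have e : ∀ m : ℕ, (∫ t in Ioo (0 : ℝ) 1,
        (gbinom (((0 : ℕ) : ℝ) + (m : ℝ) + β) m * t ^ m * (1 - t) ^ 0) • a m ∂μ) =
        (∫ t in Ioo (0 : ℝ) 1, gker β 0 m t ∂μ) • a m := fun m => integral_smul_const _ _
    unfold Hb
    simp_rw [e]
    rw [tsum_eq_sum (s := Finset.range N)]
    · rw [Complex.ofReal_sum]
      refine Finset.sum_congr rfl fun m hm => ?_
      simp [a, Finset.mem_range.1 hm]
    · intro m hm
      have : ¬ m < N := fun h => hm (Finset.mem_range.2 h)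
      simp [a, this]
  have h1 := (le_iSup (fun n : ℕ => ENNReal.ofReal ‖Hb μ β a n‖) 0).trans
    (h a (ne_top_of_le_ne_top ENNReal.one_ne_top ha))
  rw [hH, Complex.norm_real, Real.norm_of_nonneg (Finset.sum_nonneg fun m _ => hnn m),
    ENNReal.ofReal_sum_of_nonneg fun m _ => hnn m] at h1
  refine le_trans (le_of_eq ?_) (h1.trans ((mul_le_mul_right ha _).trans (mul_one _).le))
  refine Finset.sum_congr rfl fun m _ => ?_
  rw [ofReal_integral_eq_lintegral_ofReal (gker_integrable μ β 0 m)]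
  exact (ae_restrict_iff' measurableSet_Ioo).2 (ae_of_all _ fun t ht => gker_nonneg hβ 0 m ht)

lemma Hb_upper (μ : Measure ℝ) {β : ℝ} (hβ : -1 < β) (a : ℕ → ℂ) :
    (⨆ n : ℕ, ENNReal.ofReal ‖Hb μ β a n‖) ≤
      (∫⁻ t in Ioo (0 : ℝ) 1, ENNReal.ofReal ((1 - t) ^ (-β - 1)) ∂μ) *
        ⨆ n : ℕ, ENNReal.ofReal ‖a n‖ := by
  refine iSup_le fun n => ?_
  rw [← gker_tsum_lintegral μ hβ n, ← ENNReal.tsum_mul_right, ofReal_norm]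
  unfold Hb
  refine enorm_tsum_le_tsum_enorm.trans (ENNReal.tsum_le_tsum fun m => ?_)
  refine (enorm_integral_le_lintegral_enorm _).trans ?_
  have hm := (gker_continuous β n m).measurable.ennreal_ofReal
  rw [← lintegral_mul_const _ hm]
  refine setLIntegral_mono (hm.mul_const _) fun t ht => ?_
  have hk := gker_nonneg hβ n m ht
  change ‖gker β n m t • a m‖ₑ ≤ _
  rw [enorm_smul, Real.enorm_eq_ofReal hk, ← ofReal_norm (a m)]
  exact mul_le_mul_right (le_iSup (fun n : ℕ => ENNReal.ofReal ‖a n‖) m) _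

/-- For `β > -1`, `H_μ^β` is bounded on `ℓ^∞` iff
`C_μ(β,∞) = ∫_{(0,1)} (1-t)^{-β-1} dμ(t) < ∞`, and in that case the operator norm
(the least bound `M`) equals `C_μ(β,∞)`. -/
theorem Hb_bounded_linfty_iff (μ : Measure ℝ) [IsFiniteMeasure μ] (β : ℝ) (hβ : -1 < β) :
    ((∃ M : ℝ, 0 ≤ M ∧ ∀ a : ℕ → ℂ, (⨆ n : ℕ, ENNReal.ofReal ‖a n‖) ≠ ⊤ →
        (⨆ n : ℕ, ENNReal.ofReal ‖Hb μ β a n‖) ≤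
          ENNReal.ofReal M * ⨆ n : ℕ, ENNReal.ofReal ‖a n‖) ↔
      (∫⁻ t in Ioo (0 : ℝ) 1, ENNReal.ofReal ((1 - t) ^ (-β - 1)) ∂μ) ≠ ⊤) ∧
    ((∃ M : ℝ, 0 ≤ M ∧ ∀ a : ℕ → ℂ, (⨆ n : ℕ, ENNReal.ofReal ‖a n‖) ≠ ⊤ →
        (⨆ n : ℕ, ENNReal.ofReal ‖Hb μ β a n‖) ≤
          ENNReal.ofReal M * ⨆ n : ℕ, ENNReal.ofReal ‖a n‖) →
      IsLeast {M : ℝ | 0 ≤ M ∧ ∀ a : ℕ → ℂ, (⨆ n : ℕ, ENNReal.ofReal ‖a n‖) ≠ ⊤ →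
          (⨆ n : ℕ, ENNReal.ofReal ‖Hb μ β a n‖) ≤
            ENNReal.ofReal M * ⨆ n : ℕ, ENNReal.ofReal ‖a n‖}
        (∫⁻ t in Ioo (0 : ℝ) 1, ENNReal.ofReal ((1 - t) ^ (-β - 1)) ∂μ).toReal) := by
  have hup : (∫⁻ t in Ioo (0 : ℝ) 1, ENNReal.ofReal ((1 - t) ^ (-β - 1)) ∂μ) ≠ ⊤ →
      ∀ a : ℕ → ℂ, (⨆ n : ℕ, ENNReal.ofReal ‖Hb μ β a n‖) ≤
        ENNReal.ofReal (∫⁻ t in Ioo (0 : ℝ) 1, ENNReal.ofReal ((1 - t) ^ (-β - 1)) ∂μ).toReal *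
          ⨆ n : ℕ, ENNReal.ofReal ‖a n‖ := by
    intro hC a
    rw [ENNReal.ofReal_toReal hC]
    exact Hb_upper μ hβ a
  refine ⟨⟨?_, fun hC => ⟨_, ENNReal.toReal_nonneg, fun a _ => hup hC a⟩⟩, ?_⟩
  · rintro ⟨M, _, h⟩
    exact ne_top_of_le_ne_top ENNReal.ofReal_ne_top (Hb_lower μ hβ h)
  · rintro ⟨M, _, h⟩
    have hC := ne_top_of_le_ne_top ENNReal.ofReal_ne_top (Hb_lower μ hβ h)
    refine ⟨⟨ENNReal.toReal_nonneg, fun a _ => hup hC a⟩, ?_⟩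
    rintro Mb ⟨hMb, hb⟩
    exact ENNReal.toReal_le_of_le_ofReal hMb (Hb_lower μ hβ hb)
end

section
/- For all real x ≥ 0 and all t ∈ [0,1), it holds that (1-t)·(1 - t·e^{-x})^{-1} ≥ e^{-t(1-t)^{-1} x}. -/
/-- For all `x ≥ 0` and `t ∈ [0,1)`: `(1-t)(1-t e^{-x})^{-1} ≥ e^{-t(1-t)^{-1}x}`. -/
theorem one_sub_mul_inv_ge_exp (x t : ℝ) (hx : 0 ≤ x) (ht : t ∈ Set.Ico (0 : ℝ) 1) :
    (1 - t) * (1 - t * Real.exp (-x))⁻¹ ≥ Real.exp (-(t * (1 - t)⁻¹ * x)) := by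
  obtain ⟨h0, h1⟩ := ht
  have hp : 0 < 1 - t := by linarith
  have he : Real.exp (-x) ≤ 1 := Real.exp_le_one_iff.mpr (by linarith)
  have hd : 0 < 1 - t * Real.exp (-x) := by nlinarith
  have h2 := Real.add_one_le_exp (t * (1 - t)⁻¹ * x)
  have h3 := Real.add_one_le_exp (-x)
  have h4 : (1 - t) * (t * (1 - t)⁻¹ * x + 1) = t * x + (1 - t) := by
    field_simp
  have h5 := mul_le_mul_of_nonneg_left h2 hp.le
  have h6 := mul_le_mul_of_nonneg_left h3 h0
  have h7 : 1 - t * Real.exp (-x) ≤ (1 - t) * Real.exp (t * (1 - t)⁻¹ * x) := by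
    linarith
  rw [ge_iff_le, ← div_eq_mul_inv (1 - t), le_div_iff₀ hd, Real.exp_neg,
    inv_mul_le_iff₀ (Real.exp_pos _)]
  linarith
end

section
/- Let n ∈ ℕ₀. If s ∈ (-1,0), then (n+1)_s ≤ (n+1)^{s+1}/(n+s+1). If s ≥ 0, then (n+1)_s ≤ (n+s+1)^s. -/
theorem gamma_aux1 {x t : ℝ} (hx : 0 < x) (h0 : 0 ≤ t) (h1 : t ≤ 1) :
    Real.Gamma (x + t) ≤ x ^ t * Real.Gamma x := by
  have hG := Real.Gamma_pos_of_pos hx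
  rcases h0.eq_or_lt with rfl | h0
  · simp
  rcases h1.eq_or_lt with rfl | h1
  · rw [Real.Gamma_add_one hx.ne', Real.rpow_one]
  have h := Real.Gamma_mul_add_mul_le_rpow_Gamma_mul_rpow_Gamma (s := x) (t := x + 1)
    (a := 1 - t) (b := t) hx (by linarith) (by linarith) h0 (by ring)
  have e : (1 - t) * x + t * (x + 1) = x + t := by ring
  rw [e, Real.Gamma_add_one hx.ne', Real.mul_rpow hx.le hG.le] at h
  calc Real.Gamma (x + t) ≤ _ := h
    _ = x ^ t * (Real.Gamma x ^ (1 - t) * Real.Gamma x ^ t) := by ring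
    _ = x ^ t * Real.Gamma x := by
      rw [← Real.rpow_add hG, sub_add_cancel, Real.rpow_one]

theorem gamma_aux2 (k : ℕ) : ∀ {x s : ℝ}, 0 < x → 0 ≤ s → s ≤ k + 1 →
    Real.Gamma (x + s) ≤ (x + s) ^ s * Real.Gamma x := by
  induction k with
  | zero =>
    intro x s hx h0 h1
    have hG := Real.Gamma_pos_of_pos hx
    refine (gamma_aux1 hx h0 (by simpa using h1)).trans ?_
    have : x ^ s ≤ (x + s) ^ s := Real.rpow_le_rpow hx.le (by linarith) h0
    gcongr
  | succ k ih =>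
    intro x s hx h0 h1
    have hG := Real.Gamma_pos_of_pos hx
    rcases le_total s 1 with h | h
    · refine (gamma_aux1 hx h0 h).trans ?_
      have : x ^ s ≤ (x + s) ^ s := Real.rpow_le_rpow hx.le (by linarith) h0
      gcongr
    · have h2 := ih (x := x) (s := s - 1) hx (by linarith) (by push_cast at h1; linarith)
      have hp : 0 < x + (s - 1) := by linarith
      have e : x + s = (x + (s - 1)) + 1 := by ring
      calc Real.Gamma (x + s) = (x + (s - 1)) * Real.Gamma (x + (s - 1)) := by
            rw [e, Real.Gamma_add_one hp.ne']
        _ ≤ (x + (s - 1)) * ((x + (s - 1)) ^ (s - 1) * Real.Gamma x) := by gcongr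
        _ = (x + (s - 1)) ^ s * Real.Gamma x := by
            rw [Real.rpow_sub_one hp.ne']; field_simp
        _ ≤ (x + s) ^ s * Real.Gamma x := by
            have : (x + (s - 1)) ^ s ≤ (x + s) ^ s :=
              Real.rpow_le_rpow hp.le (by linarith) h0
            gcongr

/-- For `n ∈ ℕ₀`: if `s ∈ (-1,0)` then `(n+1)_s ≤ (n+1)^{s+1}/(n+s+1)`, and if `s ≥ 0`
then `(n+1)_s ≤ (n+s+1)^s`. -/
theorem poch_le (n : ℕ) (s : ℝ) :
    (s ∈ Set.Ioo (-1 : ℝ) 0 →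
      poch (n : ℝ) s ≤ ((n : ℝ) + 1) ^ (s + 1) / ((n : ℝ) + s + 1)) ∧
    (0 ≤ s → poch (n : ℝ) s ≤ ((n : ℝ) + s + 1) ^ s) := by
  have hx : (0 : ℝ) < n + 1 := by positivity
  have hG := Real.Gamma_pos_of_pos hx
  unfold poch
  constructor
  · rintro ⟨h1, h2⟩
    have hn : (0 : ℝ) ≤ n := n.cast_nonneg
    have hp : 0 < (n : ℝ) + s + 1 := by linarith
    have h := gamma_aux1 (t := s + 1) hx (by linarith) (by linarith)
    have e : (n : ℝ) + 1 + (s + 1) = (n + s + 1) + 1 := by ring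
    rw [e, Real.Gamma_add_one hp.ne'] at h
    rw [div_le_div_iff₀ hG hp]
    linarith
  · intro h0
    obtain ⟨k, hk⟩ := exists_nat_ge s
    have h := gamma_aux2 k hx h0 (by linarith)
    have e : (n : ℝ) + 1 + s = n + s + 1 := by ring
    rw [e] at h
    rwa [div_le_iff₀ hG]
end

section
/- Let μ be a positive finite Borel measure on (0,1), let 1 ≤ p < ∞, and let α, β > -1 with β - α > -1. If C_μ(β,p) = ∫_{(0,1)} (1-t)^{-(1-1/p)(β+1)} t^{-(β+1)/p} dμ(t) < ∞, then for every sequence a ∈ l^p_{w₁} one has ‖H_μ^{α,β}(a)‖_{p,w₂} ≤ C_μ(β,p) · ‖a‖_{p,w₁}; in particular H_μ^{α,β} : l^p_{w₁} → l^p_{w₂} is bounded with operator norm at most C_μ(β,p). -/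
open MeasureTheory Set

/-- The weight `w₁(m) = (m+1)_α^{-p} (m+1)_β`. -/
noncomputable def w1 (α β p : ℝ) (m : ℕ) : ℝ := (poch (m : ℝ) α) ^ (-p) * poch (m : ℝ) β

/-- The weight `w₂(m) = (m+β-α+1)_α^{-p} (m+1)_β`. -/
noncomputable def w2 (α β p : ℝ) (m : ℕ) : ℝ :=
  (poch ((m : ℝ) + β - α) α) ^ (-p) * poch (m : ℝ) β

open scoped ENNReal

lemma jensen_aux {X : Type*} [MeasurableSpace X] (ν : Measure X) {p : ℝ} (hp : 1 ≤ p)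
    {f g : X → ℝ≥0∞} (hf : AEMeasurable f ν) (hg : AEMeasurable g ν) :
    (∫⁻ x, f x * g x ∂ν) ^ p ≤ (∫⁻ x, f x ∂ν) ^ (p - 1) * ∫⁻ x, f x * g x ^ p ∂ν := by
  have hp0 : 0 < p := by linarith
  have h1 : 1 / p ≤ 1 := by rw [div_le_one hp0]; exact hp
  have h0 : 0 ≤ 1 / p := by positivity
  have key := ENNReal.lintegral_mul_norm_pow_le (μ := ν) (f := f) (g := fun x => f x * g x ^ p)
    hf (by fun_prop) (p := 1 - 1 / p) (q := 1 / p) (by linarith) h0 (by ring)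
  have e : ∀ x, f x ^ (1 - 1 / p) * (f x * g x ^ p) ^ (1 / p) = f x * g x := by
    intro x
    rw [ENNReal.mul_rpow_of_nonneg _ _ h0, ← ENNReal.rpow_mul, ← mul_assoc,
      ← ENNReal.rpow_add_of_nonneg _ _ (by linarith) h0]
    rw [mul_one_div_cancel hp0.ne']
    simp
  simp only [e] at key
  calc _ ≤ _ := ENNReal.rpow_le_rpow key hp0.le
    _ = _ := by
      rw [ENNReal.mul_rpow_of_nonneg _ _ hp0.le, ← ENNReal.rpow_mul, ← ENNReal.rpow_mul,
        one_div_mul_cancel hp0.ne', ENNReal.rpow_one]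
      congr 2
      field_simp

lemma schur_aux (ν : Measure ℝ) {p : ℝ} (hp : 1 ≤ p) (K : ℝ → ℕ → ℕ → ℝ≥0∞)
    (hK : ∀ n m, Measurable fun t => K t n m) (v A : ℕ → ℝ≥0∞) (P Q G : ℝ → ℝ≥0∞)
    (hG : Measurable G) (hG0 : ∀ᵐ t ∂ν, G t ≠ 0) (hGt : ∀ᵐ t ∂ν, G t ≠ ⊤)
    (hPQ : ∀ᵐ t ∂ν, P t ^ (p - 1) * Q t = G t ^ p)
    (h1 : ∀ᵐ t ∂ν, ∀ n, ∑' m, K t n m ≤ P t)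
    (h2 : ∀ᵐ t ∂ν, ∀ m, ∑' n, v n * K t n m ≤ v m * Q t) :
    ∑' n, v n * (∑' m, ∫⁻ t, K t n m * A m ∂ν) ^ p ≤
      (∫⁻ t, G t ∂ν) ^ p * ∑' m, v m * A m ^ p := by
  have hp0 : 0 < p := by linarith
  set S := ∑' m, v m * A m ^ p with hS
  set F : ℕ → ℝ → ℝ≥0∞ := fun n t => ∑' m, K t n m * A m with hF
  have hFm : ∀ n, Measurable (F n) := fun n =>
    Measurable.tsum fun m => (hK n m).mul_const _
  have hsw : ∀ n, ∑' m, ∫⁻ t, K t n m * A m ∂ν = ∫⁻ t, F n t ∂ν := by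
    intro n
    rw [lintegral_tsum fun m => ((hK n m).mul_const _).aemeasurable]
  have hFp : ∀ᵐ t ∂ν, ∑' n, v n * F n t ^ p ≤ G t ^ p * S := by
    filter_upwards [h1, h2, hPQ] with t h1 h2 hPQ
    have hj : ∀ n, F n t ^ p ≤ P t ^ (p - 1) * ∑' m, K t n m * A m ^ p := by
      intro n
      have := jensen_aux (Measure.count : Measure ℕ) hp (f := fun m => K t n m) (g := A)
        (by fun_prop) (by fun_prop)
      simp only [lintegral_count] at this
      refine this.trans ?_
      exact mul_le_mul_left (ENNReal.rpow_le_rpow (h1 n) (by linarith)) _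
    calc ∑' n, v n * F n t ^ p
        ≤ ∑' n, v n * (P t ^ (p - 1) * ∑' m, K t n m * A m ^ p) := by
          gcongr with n
          exact hj n
      _ = P t ^ (p - 1) * ∑' n, ∑' m, (v n * K t n m) * A m ^ p := by
          rw [← ENNReal.tsum_mul_left]
          congr 1; ext n
          rw [mul_left_comm, ← ENNReal.tsum_mul_left]
          simp only [mul_assoc]
      _ = P t ^ (p - 1) * ∑' m, (∑' n, v n * K t n m) * A m ^ p := by
          rw [ENNReal.tsum_comm]
          simp only [ENNReal.tsum_mul_right]
      _ ≤ P t ^ (p - 1) * ∑' m, (v m * Q t) * A m ^ p := by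
          gcongr with m
          exact h2 m
      _ = G t ^ p * S := by
          rw [← hPQ, hS, mul_assoc, ← ENNReal.tsum_mul_left (a := Q t)]
          congr 2; ext m; ring
  have hn : ∀ n, (∫⁻ t, F n t ∂ν) ^ p ≤
      (∫⁻ t, G t ∂ν) ^ (p - 1) * ∫⁻ t, G t * (F n t / G t) ^ p ∂ν := by
    intro n
    have e : ∫⁻ t, F n t ∂ν = ∫⁻ t, G t * (F n t / G t) ∂ν := by
      apply lintegral_congr_ae
      filter_upwards [hG0, hGt] with t a b
      rw [ENNReal.mul_div_cancel a b]
    rw [e]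
    exact jensen_aux ν hp hG.aemeasurable ((hFm n).div hG).aemeasurable
  simp only [hsw]
  calc ∑' n, v n * (∫⁻ t, F n t ∂ν) ^ p
      ≤ ∑' n, v n * ((∫⁻ t, G t ∂ν) ^ (p - 1) * ∫⁻ t, G t * (F n t / G t) ^ p ∂ν) := by
        gcongr with n
        exact hn n
    _ = (∫⁻ t, G t ∂ν) ^ (p - 1) * ∫⁻ t, ∑' n, v n * (G t * (F n t / G t) ^ p) ∂ν := by
        have hm : ∀ n, Measurable fun t => G t * (F n t / G t) ^ p := fun n => by
          have := hFm n
          fun_prop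
        rw [lintegral_tsum fun n => ((hm n).const_mul _).aemeasurable, ← ENNReal.tsum_mul_left]
        congr 1; ext n
        rw [lintegral_const_mul _ (hm n)]
        ring
    _ ≤ (∫⁻ t, G t ∂ν) ^ (p - 1) * ∫⁻ t, G t * S ∂ν := by
        refine mul_le_mul_right ?_ _
        apply lintegral_mono_ae
        filter_upwards [hG0, hGt, hFp] with t a b c
        calc ∑' n, v n * (G t * (F n t / G t) ^ p)
            = G t * ((∑' n, v n * F n t ^ p) / G t ^ p) := by
              rw [div_eq_mul_inv, ← ENNReal.tsum_mul_right, ← ENNReal.tsum_mul_left]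
              congr 1; ext n
              rw [ENNReal.div_rpow_of_nonneg _ _ hp0.le, div_eq_mul_inv]
              ring
          _ ≤ G t * S := by
              gcongr
              exact ENNReal.div_le_of_le_mul' c
    _ = _ := by
        rw [lintegral_mul_const _ hG, ← mul_assoc]
        congr 1
        nth_rw 2 [← ENNReal.rpow_one (∫⁻ t, G t ∂ν)]
        rw [← ENNReal.rpow_add_of_nonneg _ _ (by linarith) zero_le_one]
        simp

lemma negbin_aux {c t : ℝ} (hc : 0 < c) (h0 : 0 < t) (h1 : t < 1) :
    ∑' m : ℕ, ENNReal.ofReal (Real.Gamma (m + c) / Real.Gamma (m + 1) * t ^ m) =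
      ENNReal.ofReal (Real.Gamma c * (1 - t) ^ (-c)) := by
  have hG : ∀ (s b : ℝ), 0 < s → 0 < b →
      ENNReal.ofReal ((1 / b) ^ s * Real.Gamma s) =
      ∫⁻ x in Ioi (0 : ℝ), ENNReal.ofReal (x ^ (s - 1) * Real.exp (-(b * x))) := by
    intro s b hs hb
    rw [← Real.integral_rpow_mul_exp_neg_mul_Ioi hs hb]
    rw [ofReal_integral_eq_lintegral_ofReal]
    · by_contra hcon
      have h := integral_undef hcon
      rw [Real.integral_rpow_mul_exp_neg_mul_Ioi hs hb] at h
      have : 0 < (1 / b) ^ s * Real.Gamma s := mul_pos (by positivity) (Real.Gamma_pos_of_pos hs)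
      exact this.ne' h
    · filter_upwards [ae_restrict_mem measurableSet_Ioi] with x hx
      have : (0:ℝ) < x := hx
      simp only [Pi.zero_apply]; positivity
  have hm : ∀ m : ℕ, ENNReal.ofReal (Real.Gamma (m + c) / Real.Gamma (m + 1) * t ^ m) =
      ∫⁻ x in Ioi (0 : ℝ), ENNReal.ofReal (t ^ m / (Nat.factorial m : ℝ)) *
        ENNReal.ofReal (x ^ ((m + c) - 1) * Real.exp (-(1 * x))) := by
    intro m
    rw [lintegral_const_mul _ (by fun_prop), ← hG _ _ (by positivity) one_pos,
      ← ENNReal.ofReal_mul (by positivity), Real.Gamma_nat_eq_factorial]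
    congr 1
    simp
    ring
  simp only [hm]
  rw [← lintegral_tsum (fun m => by fun_prop)]
  have := hG c (1 - t) hc (by linarith)
  rw [Real.rpow_neg (by linarith), ← Real.inv_rpow (by linarith), mul_comm, ← one_div, this]
  apply setLIntegral_congr_fun measurableSet_Ioi
  intro x hx
  have hx : 0 < x := hx
  simp only
  have hs : HasSum (fun m : ℕ => (t * x) ^ m / (Nat.factorial m : ℝ)) (Real.exp (t * x)) := by
    rw [Real.exp_eq_exp_ℝ]
    exact NormedSpace.expSeries_div_hasSum_exp (t * x)
  have hs2 := hs.mul_left (x ^ (c - 1) * Real.exp (-x))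
  have e : x ^ (c - 1) * Real.exp (-((1 - t) * x)) =
      x ^ (c - 1) * Real.exp (-x) * Real.exp (t * x) := by
    rw [mul_assoc, ← Real.exp_add]; ring_nf
  rw [e, ← hs2.tsum_eq, ENNReal.ofReal_tsum_of_nonneg (fun m => by positivity) hs2.summable]
  congr 1; ext m
  rw [← ENNReal.ofReal_mul (by positivity)]
  congr 1
  rw [show (m : ℝ) + c - 1 = (c - 1) + m by ring, Real.rpow_add hx, Real.rpow_natCast, mul_pow]
  simp only [one_mul]
  ring

/-- If `C_μ(β,p) = ∫_{(0,1)} (1-t)^{-(1-1/p)(β+1)} t^{-(β+1)/p} dμ(t) < ∞`, then for every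
`a ∈ ℓ^p_{w₁}` one has `‖H_μ^{α,β}(a)‖_{p,w₂} ≤ C_μ(β,p)·‖a‖_{p,w₁}` (stated with the
`p`-th powers of the norms), so `H_μ^{α,β}` is bounded with norm at most `C_μ(β,p)`. -/
theorem Hab_norm_le (μ : Measure ℝ) [IsFiniteMeasure μ] (p α β : ℝ)
    (hp : 1 ≤ p) (hα : -1 < α) (hβ : -1 < β) (hβα : -1 < β - α)
    (hC : (∫⁻ t in Ioo (0 : ℝ) 1,
        ENNReal.ofReal ((1 - t) ^ (-(1 - 1 / p) * (β + 1)) * t ^ (-((β + 1) / p))) ∂μ) ≠ ⊤) :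
    ∀ a : ℕ → ℂ, Summable (fun m : ℕ => w1 α β p m * ‖a m‖ ^ p) →
      ∑' n : ℕ, ENNReal.ofReal (w2 α β p n * ‖Hab μ α β a n‖ ^ p) ≤
        (∫⁻ t in Ioo (0 : ℝ) 1,
            ENNReal.ofReal ((1 - t) ^ (-(1 - 1 / p) * (β + 1)) *
              t ^ (-((β + 1) / p))) ∂μ) ^ p *
          ∑' m : ℕ, ENNReal.ofReal (w1 α β p m * ‖a m‖ ^ p) := by
  intro a _
  have hp0 : 0 < p := by linarith
  have gp : ∀ x : ℝ, 0 < x → 0 < Real.Gamma x := fun x hx => Real.Gamma_pos_of_pos hx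
  have g1 : ∀ n : ℕ, 0 < Real.Gamma ((n : ℝ) + β + 1) := fun n => gp _ (by
    have : (0 : ℝ) ≤ n := n.cast_nonneg
    linarith)
  have g2 : ∀ n : ℕ, 0 < Real.Gamma ((n : ℝ) + 1) := fun n => gp _ (by positivity)
  have g3 : ∀ n : ℕ, 0 < Real.Gamma ((n : ℝ) + α + 1) := fun n => gp _ (by
    have : (0 : ℝ) ≤ n := n.cast_nonneg
    linarith)
  have g4 : ∀ n : ℕ, 0 < Real.Gamma ((n : ℝ) + β - α + 1) := fun n => gp _ (by
    have : (0 : ℝ) ≤ n := n.cast_nonneg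
    linarith)
  have g5 : ∀ n m : ℕ, 0 < Real.Gamma ((n : ℝ) + m + β + 1) := fun n m => gp _ (by
    have : (0 : ℝ) ≤ n := n.cast_nonneg
    have : (0 : ℝ) ≤ m := m.cast_nonneg
    linarith)
  set ν := μ.restrict (Ioo (0 : ℝ) 1) with hν
  have hIoo : ∀ᵐ t ∂ν, t ∈ Ioo (0 : ℝ) 1 := ae_restrict_mem measurableSet_Ioo
  set K : ℝ → ℕ → ℕ → ℝ≥0∞ := fun t n m => ENNReal.ofReal
    (Real.Gamma ((n : ℝ) + m + β + 1) / (Real.Gamma ((m : ℝ) + 1) * Real.Gamma ((n : ℝ) + β + 1))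
      * t ^ m * (1 - t) ^ n) with hKdef
  set v : ℕ → ℝ≥0∞ := fun n =>
    ENNReal.ofReal (Real.Gamma ((n : ℝ) + β + 1) / Real.Gamma ((n : ℝ) + 1)) with hv
  set A : ℕ → ℝ≥0∞ := fun m =>
    ENNReal.ofReal (Real.Gamma ((m : ℝ) + 1) / Real.Gamma ((m : ℝ) + α + 1) * ‖a m‖) with hA
  have key := schur_aux ν hp K (fun n m => by fun_prop) v A
    (fun t => ENNReal.ofReal ((1 - t) ^ (-(β + 1)))) (fun t => ENNReal.ofReal (t ^ (-(β + 1))))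
    (fun t => ENNReal.ofReal ((1 - t) ^ (-(1 - 1 / p) * (β + 1)) * t ^ (-((β + 1) / p))))
    (by fun_prop)
    (by
      filter_upwards [hIoo] with t ht
      have h0 : 0 < t := ht.1
      have h1 : 0 < 1 - t := by linarith [ht.2]
      exact (ENNReal.ofReal_pos.2 (by positivity)).ne')
    (by filter_upwards with t using ENNReal.ofReal_ne_top)
    (by
      filter_upwards [hIoo] with t ht
      have h0 : 0 < t := ht.1
      have h1 : 0 < 1 - t := by linarith [ht.2]
      rw [ENNReal.ofReal_rpow_of_pos (by positivity), ENNReal.ofReal_rpow_of_pos (by positivity),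
        ← ENNReal.ofReal_mul (by positivity), Real.mul_rpow (by positivity) (by positivity),
        ← Real.rpow_mul h1.le, ← Real.rpow_mul h1.le, ← Real.rpow_mul h0.le]
      congr 3
      · field_simp
      · field_simp)
    (by
      filter_upwards [hIoo] with t ht n
      have h0 : 0 < t := ht.1
      have h1 : 0 < 1 - t := by linarith [ht.2]
      have hc : 0 < (n : ℝ) + β + 1 := by
        have : (0 : ℝ) ≤ n := n.cast_nonneg
        linarith
      have e : ∀ m, K t n m = ENNReal.ofReal (Real.Gamma (m + ((n : ℝ) + β + 1)) /
          Real.Gamma (m + 1) * t ^ m) *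
          ENNReal.ofReal ((1 - t) ^ n / Real.Gamma ((n : ℝ) + β + 1)) := by
        intro m
        have q := g5 n m
        have := g1 n
        have := g2 m
        rw [show (n : ℝ) + m + β + 1 = m + ((n : ℝ) + β + 1) by ring] at q
        rw [← ENNReal.ofReal_mul (by positivity)]
        simp only [hKdef]
        rw [show (n : ℝ) + m + β + 1 = m + ((n : ℝ) + β + 1) by ring]
        congr 1
        field_simp
      simp only [e]
      have := g1 n
      rw [ENNReal.tsum_mul_right, negbin_aux hc h0 ht.2, ← ENNReal.ofReal_mul (by positivity)]
      apply le_of_eq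
      congr 1
      rw [show -((n : ℝ) + β + 1) = -(β + 1) - n by ring, Real.rpow_sub_natCast h1.ne']
      field_simp)
    (by
      filter_upwards [hIoo] with t ht m
      have h0 : 0 < t := ht.1
      have h1 : 0 < 1 - t := by linarith [ht.2]
      have hc : 0 < (m : ℝ) + β + 1 := by
        have : (0 : ℝ) ≤ m := m.cast_nonneg
        linarith
      have e : ∀ n, v n * K t n m = ENNReal.ofReal (Real.Gamma (n + ((m : ℝ) + β + 1)) /
          Real.Gamma (n + 1) * (1 - t) ^ n) *
          ENNReal.ofReal (t ^ m / Real.Gamma ((m : ℝ) + 1)) := by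
        intro n
        have q := g5 n m
        have := g1 n
        have := g2 m
        have := g2 n
        rw [show (n : ℝ) + m + β + 1 = n + ((m : ℝ) + β + 1) by ring] at q
        simp only [hKdef, hv]
        rw [← ENNReal.ofReal_mul (by positivity), ← ENNReal.ofReal_mul (by positivity)]
        rw [show (n : ℝ) + m + β + 1 = n + ((m : ℝ) + β + 1) by ring]
        congr 1
        field_simp
      simp only [e]
      have := g1 m
      have := g2 m
      rw [ENNReal.tsum_mul_right, negbin_aux hc h1 (by linarith)]
      simp only [hv, sub_sub_cancel]
      rw [← ENNReal.ofReal_mul (by positivity), ← ENNReal.ofReal_mul (by positivity)]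
      apply le_of_eq
      congr 1
      rw [show -((m : ℝ) + β + 1) = -(β + 1) - m by ring, Real.rpow_sub_natCast h0.ne']
      field_simp)
  have hR : ∀ m, ENNReal.ofReal (w1 α β p m * ‖a m‖ ^ p) = v m * A m ^ p := by
    intro m
    have := g1 m
    have := g2 m
    have := g3 m
    simp only [hv, hA, w1, poch]
    rw [ENNReal.ofReal_rpow_of_nonneg (by positivity) hp0.le, ← ENNReal.ofReal_mul (by positivity),
      Real.mul_rpow (by positivity) (by positivity), Real.rpow_neg (by positivity),
      ← Real.inv_rpow (by positivity), inv_div]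
    congr 1
    ring
  have hL : ∀ n, ENNReal.ofReal (w2 α β p n * ‖Hab μ α β a n‖ ^ p) ≤
      v n * (∑' m, ∫⁻ t, K t n m * A m ∂ν) ^ p := by
    intro n
    have i1 := g1 n
    have i2 := g2 n
    have i4 := g4 n
    have e : ENNReal.ofReal (w2 α β p n * ‖Hab μ α β a n‖ ^ p) = v n *
        (ENNReal.ofReal (Real.Gamma ((n : ℝ) + β - α + 1) / Real.Gamma ((n : ℝ) + β + 1)) *
          ‖Hab μ α β a n‖ₑ) ^ p := by
      simp only [hv, w2, poch]
      rw [← ofReal_norm_eq_enorm, ← ENNReal.ofReal_mul (by positivity),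
        ENNReal.ofReal_rpow_of_nonneg (by positivity) hp0.le, ← ENNReal.ofReal_mul (by positivity),
        Real.mul_rpow (by positivity) (by positivity),
        show (n : ℝ) + β - α + α + 1 = n + β + 1 by ring, Real.rpow_neg (by positivity),
        ← Real.inv_rpow (by positivity), inv_div]
      congr 1
      ring
    rw [e]
    refine mul_le_mul_right (ENNReal.rpow_le_rpow ?_ hp0.le) _
    calc _ ≤ ENNReal.ofReal (Real.Gamma ((n : ℝ) + β - α + 1) / Real.Gamma ((n : ℝ) + β + 1)) *
          ∑' m, ∫⁻ t, ‖(kker α β m n * t ^ m * (1 - t) ^ n) • a m‖ₑ ∂ν := by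
          refine mul_le_mul_right ?_ _
          refine enorm_tsum_le_tsum_enorm.trans ?_
          exact ENNReal.tsum_le_tsum fun m => enorm_integral_le_lintegral_enorm _
      _ = _ := by
          rw [← ENNReal.tsum_mul_left]
          congr 1; ext m
          rw [← lintegral_const_mul' _ _ ENNReal.ofReal_ne_top]
          apply lintegral_congr_ae
          filter_upwards [hIoo] with t ht
          have h0 : 0 < t := ht.1
          have h1 : 0 < 1 - t := by linarith [ht.2]
          have j2 := g2 m
          have j3 := g3 m
          have j5 := g5 n m
          simp only [hKdef, hA, kker]
          rw [← ofReal_norm_eq_enorm, norm_smul, Real.norm_of_nonneg (by positivity),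
            ← ENNReal.ofReal_mul (by positivity), ← ENNReal.ofReal_mul (by positivity)]
          congr 1
          field_simp
  simp only [hR]
  exact (ENNReal.tsum_le_tsum hL).trans key
end
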